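/- arXiv:2604.01419 — 4 statements merged into one kernel-verified Lean document; each statement's English description precedes it below -/
import Mathlib

section
/- There exist constants λ₀ ≥ 1, s₀ ≥ 1 and c > 0, depending only on ψ and c_ψ (and not on T), such that for every T > 0, every λ ≥ λ₀, every s ≥ (1 + 1/T) s₀, every (t,x) ∈ (0,T) × Ω and every ξ ∈ ℝ^d, one has G₂(t,x) ≥ c λ⁴ ϖ(t)³ η(x)³ and H(t,x)(ξ) ≥ c λ² ϖ(t) η(x) ‖ξ‖². -/
open MeasureTheory Metric Set Filter

/-- The spatial Hessian bilinear form of `f : ℝ^n → ℝ` at `x`, evaluated at `(ξ₁, ξ₂)`. -/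
noncomputable def hess2 {n : ℕ} (f : EuclideanSpace ℝ (Fin n) → ℝ)
    (x ξ₁ ξ₂ : EuclideanSpace ℝ (Fin n)) : ℝ :=
  fderiv ℝ (fun z => fderiv ℝ f z ξ₁) x ξ₂

/-- The Euclidean Laplacian of `f : ℝ^n → ℝ` at `x`. -/
noncomputable def lapl {n : ℕ} (f : EuclideanSpace ℝ (Fin n) → ℝ)
    (x : EuclideanSpace ℝ (Fin n)) : ℝ :=
  ∑ i, hess2 f x (EuclideanSpace.single i 1) (EuclideanSpace.single i 1)

/-- The divergence of a vector field `V : ℝ^n → ℝ^n` at `x`. -/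
noncomputable def divg {n : ℕ} (V : EuclideanSpace ℝ (Fin n) → EuclideanSpace ℝ (Fin n))
    (x : EuclideanSpace ℝ (Fin n)) : ℝ :=
  ∑ i, fderiv ℝ (fun z => V z i) x (EuclideanSpace.single i 1)

open scoped ContDiff

section SmoothBounded

variable {E F G : Type*} [NormedAddCommGroup E] [NormedSpace ℝ E]
  [NormedAddCommGroup F] [NormedSpace ℝ F] [NormedAddCommGroup G] [NormedSpace ℝ G]

/-- `f` is smooth on `Ω` and each of its iterated derivatives is bounded on `Ω`. -/
def SmoothBoundedOn (f : E → F) (Ω : Set E) : Prop :=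
  ContDiffOn ℝ ∞ f Ω ∧ ∀ m : ℕ, ∃ C : ℝ, ∀ x ∈ Ω, ‖iteratedFDeriv ℝ m f x‖ ≤ C

/-- A function smooth up to the boundary is locally bounded, with all its derivatives, near each
point of the closure. -/
theorem exists_nhdsWithin_iteratedFDeriv_le {Ω K : Set E} (hΩ : IsOpen Ω) (hΩK : Ω ⊆ K) {f : E → F}
    (hf : ContDiffOn ℝ ∞ f K) (m : ℕ) {x : E} (hx : x ∈ K) :
    ∃ t ∈ nhdsWithin x K, ∃ C : ℝ, ∀ y ∈ t ∩ Ω, ‖iteratedFDeriv ℝ m f y‖ ≤ C := by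
  obtain ⟨u, hu, p, hp⟩ :=
    contDiffWithinAt_nat.1 ((hf x hx).of_le (show ((m : ℕ) : WithTop ℕ∞) ≤ ∞ by
      exact_mod_cast le_top))
  rw [insert_eq_of_mem hx] at hu
  have hxu : x ∈ u := mem_of_mem_nhdsWithin hx hu
  have hcont : ContinuousWithinAt (fun y => ‖p y m‖) u x := (hp.cont m le_rfl x hxu).norm
  have hev : ∀ᶠ y in nhdsWithin x u, ‖p y m‖ < ‖p x m‖ + 1 :=
    hcont.eventually_lt_const (by linarith)
  have hev' : ∀ᶠ y in nhdsWithin x K, ‖p y m‖ < ‖p x m‖ + 1 := by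
    have hle : nhdsWithin x K ≤ nhdsWithin x u := nhdsWithin_le_of_mem hu
    exact hle hev
  obtain ⟨V, hVo, hxV, hVu⟩ := mem_nhdsWithin.1 hu
  refine ⟨_, inter_mem (inter_mem_nhdsWithin K (hVo.mem_nhds hxV)) hev', ‖p x m‖ + 1, ?_⟩
  rintro y ⟨⟨⟨-, hyV⟩, hy⟩, hyΩ⟩
  have hW : IsOpen (V ∩ Ω) := hVo.inter hΩ
  have hpW := hp.mono (show V ∩ Ω ⊆ u from fun z hz => hVu ⟨hz.1, hΩK hz.2⟩)
  have h := hpW.eq_iteratedFDerivWithin_of_uniqueDiffOn le_rfl hW.uniqueDiffOn ⟨hyV, hyΩ⟩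
  rw [iteratedFDerivWithin_of_isOpen m hW ⟨hyV, hyΩ⟩] at h
  rw [← h]
  exact le_of_lt hy

theorem SmoothBoundedOn.of_isCompact {Ω K : Set E} (hΩ : IsOpen Ω) (hΩK : Ω ⊆ K)
    (hK : IsCompact K) {f : E → F} (hf : ContDiffOn ℝ ∞ f K) : SmoothBoundedOn f Ω := by
  refine ⟨hf.mono hΩK, fun m => ?_⟩
  have h : ∃ C : ℝ, ∀ y ∈ K ∩ Ω, ‖iteratedFDeriv ℝ m f y‖ ≤ C := by
    refine hK.induction_on (p := fun s => ∃ C : ℝ, ∀ y ∈ s ∩ Ω, ‖iteratedFDeriv ℝ m f y‖ ≤ C)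
      ⟨0, by simp⟩ ?_ ?_ fun x hx => exists_nhdsWithin_iteratedFDeriv_le hΩ hΩK hf m hx
    · rintro s t hst ⟨C, hC⟩
      exact ⟨C, fun y hy => hC y ⟨hst hy.1, hy.2⟩⟩
    · rintro s t ⟨C, hC⟩ ⟨D, hD⟩
      refine ⟨max C D, ?_⟩
      rintro y ⟨hy | hy, hyΩ⟩
      · exact (hC y ⟨hy, hyΩ⟩).trans (le_max_left _ _)
      · exact (hD y ⟨hy, hyΩ⟩).trans (le_max_right _ _)
  obtain ⟨C, hC⟩ := h
  exact ⟨C, fun y hy => hC y ⟨hΩK hy, hy⟩⟩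

namespace SmoothBoundedOn

variable {Ω : Set E} {f : E → F}

theorem exists_norm_le (hf : SmoothBoundedOn f Ω) : ∃ C : ℝ, ∀ x ∈ Ω, ‖f x‖ ≤ C := by
  simpa using hf.2 0

theorem differentiableAt (hf : SmoothBoundedOn f Ω) (hΩ : IsOpen Ω) {x : E} (hx : x ∈ Ω) :
    DifferentiableAt ℝ f x :=
  (hf.1.contDiffAt (hΩ.mem_nhds hx)).differentiableAt (by simp)

protected theorem fderiv (hf : SmoothBoundedOn f Ω) (hΩ : IsOpen Ω) :
    SmoothBoundedOn (fderiv ℝ f) Ω :=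
  ⟨hf.1.fderiv_of_isOpen hΩ (by simp), fun m => by
    simpa only [norm_iteratedFDeriv_fderiv] using hf.2 (m + 1)⟩

theorem clm_comp (hf : SmoothBoundedOn f Ω) (hΩ : IsOpen Ω) (L : F →L[ℝ] G) :
    SmoothBoundedOn (fun z => L (f z)) Ω := by
  refine ⟨L.contDiff.comp_contDiffOn hf.1, fun m => ?_⟩
  obtain ⟨C, hC⟩ := hf.2 m
  refine ⟨‖L‖ * C, fun x hx => ?_⟩
  have h := L.norm_iteratedFDerivWithin_comp_left (hf.1 x hx) hΩ.uniqueDiffOn hx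
    (show ((m : ℕ) : WithTop ℕ∞) ≤ ∞ by exact_mod_cast le_top)
  rw [iteratedFDerivWithin_of_isOpen m hΩ hx, iteratedFDerivWithin_of_isOpen m hΩ hx] at h
  exact h.trans (mul_le_mul_of_nonneg_left (hC x hx) (norm_nonneg _))

theorem fderiv_apply (hf : SmoothBoundedOn f Ω) (hΩ : IsOpen Ω) (v : E) :
    SmoothBoundedOn (fun z => fderiv ℝ f z v) Ω :=
  (hf.fderiv hΩ).clm_comp hΩ (ContinuousLinearMap.apply ℝ F v)

theorem add {g : E → F} (hf : SmoothBoundedOn f Ω) (hg : SmoothBoundedOn g Ω) (hΩ : IsOpen Ω) :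
    SmoothBoundedOn (fun z => f z + g z) Ω := by
  refine ⟨hf.1.add hg.1, fun m => ?_⟩
  obtain ⟨C, hC⟩ := hf.2 m
  obtain ⟨D, hD⟩ := hg.2 m
  refine ⟨C + D, fun x hx => ?_⟩
  have hm : ((m : ℕ) : WithTop ℕ∞) ≤ ∞ := by exact_mod_cast le_top
  have h := iteratedFDerivWithin_add_apply ((hf.1 x hx).of_le hm) ((hg.1 x hx).of_le hm)
    hΩ.uniqueDiffOn hx
  simp only [iteratedFDerivWithin_of_isOpen m hΩ hx] at h
  change ‖iteratedFDeriv ℝ m (f + g) x‖ ≤ _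
  rw [h]
  exact (norm_add_le _ _).trans (add_le_add (hC x hx) (hD x hx))

theorem mul {f g : E → ℝ} (hf : SmoothBoundedOn f Ω) (hg : SmoothBoundedOn g Ω)
    (hΩ : IsOpen Ω) : SmoothBoundedOn (fun z => f z * g z) Ω := by
  refine ⟨hf.1.mul hg.1, fun m => ?_⟩
  choose C hC using hf.2
  choose D hD using hg.2
  refine ⟨∑ i ∈ Finset.range (m + 1), (m.choose i) * C i * D (m - i), fun x hx => ?_⟩
  have h := norm_iteratedFDerivWithin_mul_le hf.1 hg.1 hΩ.uniqueDiffOn hx (n := m)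
    (by exact_mod_cast le_top)
  have heq : ∀ (k : ℕ) (g : E → ℝ), iteratedFDerivWithin ℝ k g Ω x = iteratedFDeriv ℝ k g x :=
    fun k g => iteratedFDerivWithin_of_isOpen k hΩ hx
  simp only [heq] at h
  refine h.trans (Finset.sum_le_sum fun i _ => ?_)
  have h₁ := hC i x hx
  have h₂ := hD (m - i) x hx
  have h₃ := (norm_nonneg _).trans h₁
  gcongr

theorem const (c : F) : SmoothBoundedOn (fun _ : E => c) Ω := by
  refine ⟨contDiffOn_const, fun m => ?_⟩
  rcases eq_or_ne m 0 with rfl | hm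
  · exact ⟨‖c‖, by simp⟩
  · exact ⟨0, fun x _ => by simp [iteratedFDeriv_const_of_ne hm]⟩

theorem sum {ι : Type*} (s : Finset ι) {f : ι → E → F} (hf : ∀ i, SmoothBoundedOn (f i) Ω)
    (hΩ : IsOpen Ω) : SmoothBoundedOn (fun z => ∑ i ∈ s, f i z) Ω := by
  classical
  induction s using Finset.induction_on with
  | empty => simpa using const 0
  | insert i s hi ih => simpa only [Finset.sum_insert hi] using (hf i).add ih hΩ

end SmoothBoundedOn

end SmoothBounded

section Weight

variable {n : ℕ} {Ω : Set (EuclideanSpace ℝ (Fin n))}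

theorem SmoothBoundedOn.lapl {f : EuclideanSpace ℝ (Fin n) → ℝ} (hf : SmoothBoundedOn f Ω)
    (hΩ : IsOpen Ω) : SmoothBoundedOn (lapl f) Ω :=
  SmoothBoundedOn.sum _ (fun _ => (hf.fderiv_apply hΩ _).fderiv_apply hΩ _) hΩ

theorem SmoothBoundedOn.exists_hess2_le {f : EuclideanSpace ℝ (Fin n) → ℝ}
    (hf : SmoothBoundedOn f Ω) (hΩ : IsOpen Ω) :
    ∃ C : ℝ, ∀ x ∈ Ω, ∀ ξ, |hess2 f x ξ ξ| ≤ C * ‖ξ‖ ^ 2 := by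
  obtain ⟨C, hC⟩ := ((hf.fderiv hΩ).fderiv hΩ).exists_norm_le
  refine ⟨C, fun x hx ξ => ?_⟩
  have h : hess2 f x ξ ξ = fderiv ℝ (fderiv ℝ f) x ξ ξ := by
    have := ((ContinuousLinearMap.apply ℝ ℝ ξ).hasFDerivAt.comp x
      ((hf.fderiv hΩ).differentiableAt hΩ hx).hasFDerivAt).fderiv
    exact congrArg (fun L => L ξ) this
  rw [h, ← Real.norm_eq_abs, pow_two, ← mul_assoc]
  refine (ContinuousLinearMap.le_opNorm _ _).trans ?_
  gcongr
  refine (ContinuousLinearMap.le_opNorm _ _).trans ?_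
  gcongr
  exact hC x hx

/-- The sum of the products of the partial derivatives, i.e. the inner product of gradients. -/
noncomputable def gradDot (f g : EuclideanSpace ℝ (Fin n) → ℝ) (x : EuclideanSpace ℝ (Fin n)) : ℝ :=
  ∑ i, fderiv ℝ f x (EuclideanSpace.single i 1) * fderiv ℝ g x (EuclideanSpace.single i 1)

theorem SmoothBoundedOn.gradDot {f g : EuclideanSpace ℝ (Fin n) → ℝ} (hf : SmoothBoundedOn f Ω)
    (hg : SmoothBoundedOn g Ω) (hΩ : IsOpen Ω) : SmoothBoundedOn (gradDot f g) Ω :=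
  SmoothBoundedOn.sum _ (fun _ => (hf.fderiv_apply hΩ _).mul (hg.fderiv_apply hΩ _) hΩ) hΩ

theorem gradient_apply (f : EuclideanSpace ℝ (Fin n) → ℝ) (x : EuclideanSpace ℝ (Fin n))
    (i : Fin n) : gradient f x i = fderiv ℝ f x (EuclideanSpace.single i 1) := by
  rw [← inner_gradient_left, EuclideanSpace.inner_single_right]
  simp

theorem gradDot_self (f : EuclideanSpace ℝ (Fin n) → ℝ) (x : EuclideanSpace ℝ (Fin n)) :
    gradDot f f x = ‖gradient f x‖ ^ 2 := by
  simp [EuclideanSpace.norm_sq_eq, gradient_apply, gradDot, ← pow_two]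

theorem fderiv_exp_mul {ψ w : EuclideanSpace ℝ (Fin n) → ℝ} {x : EuclideanSpace ℝ (Fin n)}
    (hψ : DifferentiableAt ℝ ψ x) (hw : DifferentiableAt ℝ w x) (lam a : ℝ)
    (ξ : EuclideanSpace ℝ (Fin n)) :
    fderiv ℝ (fun z => Real.exp (lam * (ψ z + a)) * w z) x ξ
      = Real.exp (lam * (ψ x + a)) * (lam * fderiv ℝ ψ x ξ * w x + fderiv ℝ w x ξ) := by
  have h := (((hψ.hasFDerivAt.add_const a).const_mul lam).exp.mul hw.hasFDerivAt).fderiv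
  have h' := congrArg (fun L => L ξ) h
  refine h'.trans ?_
  simp only [add_apply, smul_apply, smul_eq_mul]
  ring

theorem hess2_exp_mul (hΩ : IsOpen Ω) {ψ w : EuclideanSpace ℝ (Fin n) → ℝ}
    (hψ : SmoothBoundedOn ψ Ω) (hw : SmoothBoundedOn w Ω) {x : EuclideanSpace ℝ (Fin n)}
    (hx : x ∈ Ω) (lam a : ℝ) (ξ₁ ξ₂ : EuclideanSpace ℝ (Fin n)) :
    hess2 (fun z => Real.exp (lam * (ψ z + a)) * w z) x ξ₁ ξ₂
      = Real.exp (lam * (ψ x + a)) *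
        (lam ^ 2 * (fderiv ℝ ψ x ξ₁ * fderiv ℝ ψ x ξ₂) * w x + lam * hess2 ψ x ξ₁ ξ₂ * w x
          + lam * (fderiv ℝ ψ x ξ₁ * fderiv ℝ w x ξ₂) + lam * (fderiv ℝ ψ x ξ₂ * fderiv ℝ w x ξ₁)
          + hess2 w x ξ₁ ξ₂) := by
  have hev : (fun z => fderiv ℝ (fun z => Real.exp (lam * (ψ z + a)) * w z) z ξ₁) =ᶠ[nhds x]
      fun z => Real.exp (lam * (ψ z + a)) * (lam * fderiv ℝ ψ z ξ₁ * w z + fderiv ℝ w z ξ₁) := by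
    filter_upwards [hΩ.mem_nhds hx] with z hz
    exact fderiv_exp_mul (hψ.differentiableAt hΩ hz) (hw.differentiableAt hΩ hz) lam a ξ₁
  have dψ := (hψ.fderiv_apply hΩ ξ₁).differentiableAt hΩ hx
  have dw := (hw.fderiv_apply hΩ ξ₁).differentiableAt hΩ hx
  have d := hw.differentiableAt hΩ hx
  have h := congrArg (fun L => L ξ₂)
    (((dψ.hasFDerivAt.const_mul lam).mul d.hasFDerivAt).add dw.hasFDerivAt).fderiv
  unfold hess2
  rw [hev.fderiv_eq]
  refine (fderiv_exp_mul (hψ.differentiableAt hΩ hx)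
    (((dψ.const_mul lam).mul d).add dw) lam a ξ₂).trans ?_
  refine (congrArg (fun r => Real.exp (lam * (ψ x + a)) * (lam * fderiv ℝ ψ x ξ₂ *
    (lam * fderiv ℝ ψ x ξ₁ * w x + fderiv ℝ w x ξ₁) + r)) h).trans ?_
  simp only [add_apply, smul_apply, smul_eq_mul]
  ring

theorem lapl_exp_mul (hΩ : IsOpen Ω) {ψ w : EuclideanSpace ℝ (Fin n) → ℝ}
    (hψ : SmoothBoundedOn ψ Ω) (hw : SmoothBoundedOn w Ω) {x : EuclideanSpace ℝ (Fin n)}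
    (hx : x ∈ Ω) (lam a : ℝ) :
    lapl (fun z => Real.exp (lam * (ψ z + a)) * w z) x
      = Real.exp (lam * (ψ x + a)) *
        (lam ^ 2 * gradDot ψ ψ x * w x + lam * lapl ψ x * w x + 2 * lam * gradDot ψ w x
          + lapl w x) := by
  unfold lapl gradDot
  simp only [hess2_exp_mul hΩ hψ hw hx, Finset.mul_sum, Finset.sum_mul, ← Finset.sum_add_distrib]
  refine Finset.sum_congr rfl fun i _ => ?_
  ring

theorem fderiv_lin {f g : EuclideanSpace ℝ (Fin n) → ℝ} {x : EuclideanSpace ℝ (Fin n)}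
    (hf : DifferentiableAt ℝ f x) (hg : DifferentiableAt ℝ g x) (a b : ℝ)
    (ξ : EuclideanSpace ℝ (Fin n)) :
    fderiv ℝ (fun z => a * f z + b * g z) x ξ = a * fderiv ℝ f x ξ + b * fderiv ℝ g x ξ := by
  have h := congrArg (fun L => L ξ)
    ((hf.hasFDerivAt.const_mul a).add (hg.hasFDerivAt.const_mul b)).fderiv
  exact h

theorem lapl_lin (hΩ : IsOpen Ω) {f g : EuclideanSpace ℝ (Fin n) → ℝ}
    (hf : SmoothBoundedOn f Ω) (hg : SmoothBoundedOn g Ω) {x : EuclideanSpace ℝ (Fin n)}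
    (hx : x ∈ Ω) (a b : ℝ) :
    lapl (fun z => a * f z + b * g z) x = a * lapl f x + b * lapl g x := by
  unfold lapl
  rw [Finset.mul_sum, Finset.mul_sum, ← Finset.sum_add_distrib]
  refine Finset.sum_congr rfl fun i _ => ?_
  have hev : (fun z => fderiv ℝ (fun z => a * f z + b * g z) z (EuclideanSpace.single i 1))
      =ᶠ[nhds x] fun z => a * fderiv ℝ f z (EuclideanSpace.single i 1)
        + b * fderiv ℝ g z (EuclideanSpace.single i 1) := by
    filter_upwards [hΩ.mem_nhds hx] with z hz
    exact fderiv_lin (hf.differentiableAt hΩ hz) (hg.differentiableAt hΩ hz) a b _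
  unfold hess2
  rw [hev.fderiv_eq, fderiv_lin ((hf.fderiv_apply hΩ _).differentiableAt hΩ hx)
    ((hg.fderiv_apply hΩ _).differentiableAt hΩ hx)]

theorem lapl_congr {f g : EuclideanSpace ℝ (Fin n) → ℝ} {x : EuclideanSpace ℝ (Fin n)}
    (h : f =ᶠ[nhds x] g) : lapl f x = lapl g x := by
  unfold lapl hess2
  refine Finset.sum_congr rfl fun i _ => ?_
  have hev : (fun z => fderiv ℝ f z (EuclideanSpace.single i 1))
      =ᶠ[nhds x] fun z => fderiv ℝ g z (EuclideanSpace.single i 1) := by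
    filter_upwards [h.fderiv (𝕜 := ℝ)] with z hz
    rw [hz]
  rw [hev.fderiv_eq]

theorem divg_smul_gradient {f g : EuclideanSpace ℝ (Fin n) → ℝ} {x : EuclideanSpace ℝ (Fin n)}
    (hf : DifferentiableAt ℝ f x)
    (hg : ∀ ξ, DifferentiableAt ℝ (fun z => fderiv ℝ g z ξ) x) :
    divg (fun z => f z • gradient g z) x = gradDot f g x + f x * lapl g x := by
  unfold divg gradDot lapl
  rw [Finset.mul_sum, ← Finset.sum_add_distrib]
  refine Finset.sum_congr rfl fun i _ => ?_
  have h := congrArg (fun L => L (EuclideanSpace.single i 1))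
    (hf.hasFDerivAt.mul (hg (EuclideanSpace.single i 1)).hasFDerivAt).fderiv
  have hfun : (fun z => (f z • gradient g z) i)
      = f * fun z => fderiv ℝ g z (EuclideanSpace.single i 1) := by
    funext z
    simp [gradient_apply]
  rw [hfun]
  refine h.trans ?_
  simp only [add_apply, smul_apply, smul_eq_mul, hess2]
  ring

/-- The spatial profile `r (K - exp (lam (ψ + a)))` of the weight. -/
noncomputable def weight (ψ : EuclideanSpace ℝ (Fin n) → ℝ) (lam a K r : ℝ)
    (z : EuclideanSpace ℝ (Fin n)) : ℝ :=
  r * (K - Real.exp (lam * (ψ z + a)))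

variable {ψ : EuclideanSpace ℝ (Fin n) → ℝ} {x : EuclideanSpace ℝ (Fin n)}

theorem fderiv_weight_eq (lam a K r : ℝ) :
    fderiv ℝ (weight ψ lam a K r)
      = fderiv ℝ (fun z => Real.exp (lam * (ψ z + a)) * (fun _ => -r) z) := by
  have h : weight ψ lam a K r
      = fun z => Real.exp (lam * (ψ z + a)) * (fun _ => -r) z + r * K := by
    funext z
    unfold weight
    ring
  funext z
  rw [h, fderiv_add_const]

theorem fderiv_weight (hψ : DifferentiableAt ℝ ψ x) (lam a K r : ℝ)
    (ξ : EuclideanSpace ℝ (Fin n)) :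
    fderiv ℝ (weight ψ lam a K r) x ξ
      = -(r * lam * Real.exp (lam * (ψ x + a))) * fderiv ℝ ψ x ξ := by
  rw [fderiv_weight_eq, fderiv_exp_mul hψ (differentiableAt_const _)]
  simp
  ring

theorem gradient_weight (hψ : DifferentiableAt ℝ ψ x) (lam a K r : ℝ) :
    gradient (weight ψ lam a K r) x
      = (-(r * lam * Real.exp (lam * (ψ x + a)))) • gradient ψ x := by
  ext i
  simp only [gradient_apply, fderiv_weight hψ, PiLp.smul_apply, smul_eq_mul]

theorem hess2_weight (hΩ : IsOpen Ω) (hψ : SmoothBoundedOn ψ Ω) (hx : x ∈ Ω) (lam a K r : ℝ)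
    (ξ₁ ξ₂ : EuclideanSpace ℝ (Fin n)) :
    hess2 (weight ψ lam a K r) x ξ₁ ξ₂
      = -(r * Real.exp (lam * (ψ x + a))) *
        (lam ^ 2 * (fderiv ℝ ψ x ξ₁ * fderiv ℝ ψ x ξ₂) + lam * hess2 ψ x ξ₁ ξ₂) := by
  have h : hess2 (weight ψ lam a K r) x ξ₁ ξ₂
      = hess2 (fun z => Real.exp (lam * (ψ z + a)) * (fun _ => -r) z) x ξ₁ ξ₂ := by
    unfold hess2
    rw [fderiv_weight_eq]
  rw [h, hess2_exp_mul hΩ hψ (SmoothBoundedOn.const _) hx]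
  simp [hess2]
  ring

theorem lapl_weight (hΩ : IsOpen Ω) (hψ : SmoothBoundedOn ψ Ω) (hx : x ∈ Ω) (lam a K r : ℝ) :
    lapl (weight ψ lam a K r) x
      = -(r * Real.exp (lam * (ψ x + a))) * (lam ^ 2 * gradDot ψ ψ x + lam * lapl ψ x) := by
  unfold lapl gradDot
  simp only [hess2_weight hΩ hψ hx, Finset.mul_sum, ← Finset.sum_add_distrib]

theorem lapl_lapl_weight (hΩ : IsOpen Ω) (hψ : SmoothBoundedOn ψ Ω) (hx : x ∈ Ω)
    (lam a K r : ℝ) :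
    lapl (fun z => lapl (weight ψ lam a K r) z) x
      = -(r * Real.exp (lam * (ψ x + a))) * ((lam ^ 2 * gradDot ψ ψ x + lam * lapl ψ x) ^ 2
        + 2 * lam * (lam ^ 2 * gradDot ψ (gradDot ψ ψ) x + lam * gradDot ψ (lapl ψ) x)
        + (lam ^ 2 * lapl (gradDot ψ ψ) x + lam * lapl (lapl ψ) x)) := by
  have hP := hψ.gradDot hψ hΩ
  have hB := hψ.lapl hΩ
  have hw : SmoothBoundedOn
      (fun z => -(r * lam ^ 2) * gradDot ψ ψ z + -(r * lam) * lapl ψ z) Ω :=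
    ((SmoothBoundedOn.const _).mul hP hΩ).add ((SmoothBoundedOn.const _).mul hB hΩ) hΩ
  have hev : (fun z => lapl (weight ψ lam a K r) z) =ᶠ[nhds x] fun z =>
      Real.exp (lam * (ψ z + a)) *
        (fun z => -(r * lam ^ 2) * gradDot ψ ψ z + -(r * lam) * lapl ψ z) z := by
    filter_upwards [hΩ.mem_nhds hx] with z hz
    rw [lapl_weight hΩ hψ hz]
    ring
  have hdot : gradDot ψ (fun z => -(r * lam ^ 2) * gradDot ψ ψ z + -(r * lam) * lapl ψ z) x
      = -(r * lam ^ 2) * gradDot ψ (gradDot ψ ψ) x + -(r * lam) * gradDot ψ (lapl ψ) x := by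
    conv_lhs => unfold gradDot
    rw [gradDot.eq_1 ψ (gradDot ψ ψ) x, gradDot.eq_1 ψ (lapl ψ) x, Finset.mul_sum,
      Finset.mul_sum, ← Finset.sum_add_distrib]
    refine Finset.sum_congr rfl fun i _ => ?_
    have h := fderiv_lin (hP.differentiableAt hΩ hx) (hB.differentiableAt hΩ hx)
      (-(r * lam ^ 2)) (-(r * lam)) (EuclideanSpace.single i 1)
    refine (congrArg (fun r => fderiv ℝ ψ x (EuclideanSpace.single i 1) * r) h).trans ?_
    ring
  rw [lapl_congr hev, lapl_exp_mul hΩ hψ hw hx, hdot, lapl_lin hΩ hP hB hx]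
  ring

theorem contDiffOn_weight (hψ : SmoothBoundedOn ψ Ω) (lam a K r : ℝ) :
    ContDiffOn ℝ ∞ (weight ψ lam a K r) Ω :=
  contDiffOn_const.mul (contDiffOn_const.sub
    (contDiffOn_const.mul (hψ.1.add contDiffOn_const)).exp)

theorem divg_weight (hΩ : IsOpen Ω) (hψ : SmoothBoundedOn ψ Ω) (hx : x ∈ Ω) (lam a K r v : ℝ) :
    divg (fun z => weight ψ lam a K v z • gradient (weight ψ lam a K r) z) x
      = v * r * lam ^ 2 * Real.exp (lam * (ψ x + a)) ^ 2 * gradDot ψ ψ x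
        + weight ψ lam a K v x * lapl (weight ψ lam a K r) x := by
  have hn := hΩ.mem_nhds hx
  rw [divg_smul_gradient
    (((contDiffOn_weight hψ lam a K v).contDiffAt hn).differentiableAt (by simp)) fun ξ => ?_]
  · congr 1
    unfold gradDot
    simp only [fderiv_weight (hψ.differentiableAt hΩ hx), Finset.mul_sum]
    refine Finset.sum_congr rfl fun i _ => ?_
    ring
  · have h := ((contDiffOn_weight hψ lam a K r).fderiv_of_isOpen hΩ
      (m := ∞) (by simp)).contDiffAt hn
    exact (h.differentiableAt (by simp)).clm_apply (differentiableAt_const _)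

end Weight

section TimeFactor

theorem hasDerivAt_timeFactor {T t : ℝ} (ht : t ∈ Ioo 0 T) :
    HasDerivAt (fun t' : ℝ => 1 / (4 * (t' / T) * (1 - t' / T)))
      (-(4 * ((1 - 2 * (t / T)) / T)) * (1 / (4 * (t / T) * (1 - t / T))) ^ 2) t := by
  have hT : 0 < T := ht.1.trans ht.2
  have h₁ : t / T ≠ 0 := (div_pos ht.1 hT).ne'
  have h₂ : 1 - t / T ≠ 0 := (sub_pos.2 ((div_lt_one hT).2 ht.2)).ne'
  have hd : HasDerivAt (fun t' : ℝ => t' / T) (1 / T) t := (hasDerivAt_id t).div_const T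
  have h := ((hd.const_mul 4).mul (hd.const_sub 1)).inv
    (mul_ne_zero (mul_ne_zero four_ne_zero h₁) h₂)
  have hfun : (fun t' : ℝ => 1 / (4 * (t' / T) * (1 - t' / T)))
      = ((fun t' : ℝ => 4 * (t' / T)) * fun t' => 1 - t' / T)⁻¹ := by
    funext t'
    simp
  rw [hfun]
  refine h.congr_deriv ?_
  simp only [Pi.mul_apply]
  generalize t / T = q at *
  field_simp
  ring

theorem one_le_timeFactor {T t : ℝ} (ht : t ∈ Ioo 0 T) :
    1 ≤ 1 / (4 * (t / T) * (1 - t / T)) := by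
  have hT : 0 < T := ht.1.trans ht.2
  have h₁ : 0 < t / T := div_pos ht.1 hT
  have h₂ : 0 < 1 - t / T := sub_pos.2 ((div_lt_one hT).2 ht.2)
  rw [le_div_iff₀ (by positivity)]
  nlinarith [sq_nonneg (2 * (t / T) - 1)]

theorem abs_one_sub_two_mul_div_le {T t : ℝ} (ht : t ∈ Ioo 0 T) :
    |(1 - 2 * (t / T)) / T| ≤ 1 / T := by
  have hT : 0 < T := ht.1.trans ht.2
  have h₁ : 0 < t / T := div_pos ht.1 hT
  have h₂ : 0 < 1 - t / T := sub_pos.2 ((div_lt_one hT).2 ht.2)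
  rw [abs_div, abs_of_pos hT]
  gcongr
  rw [abs_le]
  constructor <;> linarith

theorem abs_deriv_timeFactor_le {T t : ℝ} (ht : t ∈ Ioo 0 T) :
    |deriv (fun t' : ℝ => 1 / (4 * (t' / T) * (1 - t' / T))) t|
      ≤ 4 * (1 / (4 * (t / T) * (1 - t / T))) ^ 2 / T := by
  rw [(hasDerivAt_timeFactor ht).deriv, abs_mul, abs_neg, abs_mul, abs_pow, sq_abs,
    abs_of_pos (by norm_num : (0 : ℝ) < 4)]
  have h := mul_le_mul_of_nonneg_right (abs_one_sub_two_mul_div_le ht)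
    (sq_nonneg (1 / (4 * (t / T) * (1 - t / T))))
  calc _ = 4 * (|(1 - 2 * (t / T)) / T| * (1 / (4 * (t / T) * (1 - t / T))) ^ 2) := by ring
    _ ≤ 4 * (1 / T * (1 / (4 * (t / T) * (1 - t / T))) ^ 2) := by linarith
    _ = _ := by ring

theorem abs_deriv_deriv_timeFactor_le {T t : ℝ} (ht : t ∈ Ioo 0 T) :
    |deriv (fun s => deriv (fun t' : ℝ => 1 / (4 * (t' / T) * (1 - t' / T))) s) t|
      ≤ 40 * (1 / (4 * (t / T) * (1 - t / T))) ^ 3 / T ^ 2 := by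
  have hT : 0 < T := ht.1.trans ht.2
  have hev : (fun s => deriv (fun t' : ℝ => 1 / (4 * (t' / T) * (1 - t' / T))) s) =ᶠ[nhds t]
      fun s => -(4 * ((1 - 2 * (s / T)) / T)) * (1 / (4 * (s / T) * (1 - s / T))) ^ 2 := by
    filter_upwards [isOpen_Ioo.mem_nhds ht] with s hs
    exact (hasDerivAt_timeFactor hs).deriv
  have hd : HasDerivAt (fun t' : ℝ => t' / T) (1 / T) t := (hasDerivAt_id t).div_const T
  have h := ((((hd.const_mul 2).const_sub 1).div_const T).const_mul 4).neg.mul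
    ((hasDerivAt_timeFactor ht).pow 2)
  have hr := one_le_timeFactor ht
  have hq := sq_le_sq' (neg_le_of_abs_le (abs_one_sub_two_mul_div_le ht))
    (le_of_abs_le (abs_one_sub_two_mul_div_le ht))
  rw [hev.deriv_eq]
  erw [h.deriv]
  simp only [Pi.pow_apply, Pi.neg_apply]
  generalize 1 / (4 * (t / T) * (1 - t / T)) = r at *
  generalize (1 - 2 * (t / T)) / T = q at *
  have hval : -(4 * (-(2 * (1 / T)) / T)) * r ^ 2
      + -(4 * q) * ((2 : ℕ) * r ^ (2 - 1) * (-(4 * q) * r ^ 2))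
      = 8 * (1 / T) ^ 2 * r ^ 2 + 32 * q ^ 2 * r ^ 3 := by
    push_cast
    ring
  rw [hval, abs_of_nonneg (by positivity)]
  have h₁ : (1 / T) ^ 2 * r ^ 2 ≤ (1 / T) ^ 2 * r ^ 3 := by
    gcongr
    norm_num
  have h₂ : q ^ 2 * r ^ 3 ≤ (1 / T) ^ 2 * r ^ 3 := by gcongr
  calc _ ≤ 40 * ((1 / T) ^ 2 * r ^ 3) := by linarith
    _ = _ := by ring

end TimeFactor
section RealEstimates

variable {C m lam r E p b : ℝ}

theorem abs_lapl_factor_le (hlam : 1 ≤ lam) (hp₀ : 0 ≤ p) (hp : p ≤ C) (hb : |b| ≤ C) :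
    |lam ^ 2 * p + lam * b| ≤ 2 * C * lam ^ 2 := by
  have h : lam * |b| ≤ lam ^ 2 * C := by
    have : lam ≤ lam ^ 2 := by nlinarith
    gcongr
  calc |lam ^ 2 * p + lam * b| ≤ |lam ^ 2 * p| + |lam * b| := abs_add_le _ _
    _ = lam ^ 2 * p + lam * |b| := by
      rw [abs_of_nonneg (by positivity), abs_mul, abs_of_nonneg (by linarith : 0 ≤ lam)]
    _ ≤ lam ^ 2 * C + lam ^ 2 * C := by gcongr
    _ = _ := by ring

theorem quadratic_form_lower_bound {N u k : ℝ} (hm : 0 < m) (hlam : 1 ≤ lam)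
    (hlam' : 6 * C / m ^ 2 ≤ lam) (hr : 1 ≤ r) (hE : 1 ≤ E) (hN : 0 ≤ N) (hmp : m ^ 2 ≤ p)
    (hb : |b| ≤ C) (hk : |k| ≤ C * N) :
    m ^ 2 / 2 * lam ^ 2 * r * E * N
      ≤ -2 * (-(r * E) * (lam ^ 2 * (u * u) + lam * k))
        - -(r * E) * (lam ^ 2 * p + lam * b) * N := by
  have hC : 0 ≤ C := (abs_nonneg _).trans hb
  rw [div_le_iff₀ (by positivity)] at hlam'
  have h₁ : -(C * N) ≤ k := neg_le_of_abs_le hk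
  have h₂ : -C * N ≤ b * N := mul_le_mul_of_nonneg_right (neg_le_of_abs_le hb) hN
  have h₃ : m ^ 2 * N ≤ p * N := mul_le_mul_of_nonneg_right hmp hN
  have h₄ : 6 * C * (lam * N) ≤ lam * m ^ 2 * (lam * N) := by gcongr
  have h₅ : lam * (-(C * N)) ≤ lam * k := by gcongr
  have h₆ : lam * (-C * N) ≤ lam * (b * N) := by gcongr
  have h₇ : lam ^ 2 * (m ^ 2 * N) ≤ lam ^ 2 * (p * N) := by gcongr
  have key : m ^ 2 / 2 * lam ^ 2 * N
      ≤ 2 * (lam ^ 2 * (u * u) + lam * k) + (lam ^ 2 * p + lam * b) * N := by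
    have : 0 ≤ lam ^ 2 * (u * u) := mul_nonneg (sq_nonneg _) (mul_self_nonneg _)
    linarith
  have := mul_le_mul_of_nonneg_left key (show 0 ≤ r * E by positivity)
  linarith

theorem cubic_term_lower_bound {u k : ℝ} (hm : 0 < m) (hlam : 1 ≤ lam)
    (hlam' : 12 * C ^ 2 / m ^ 4 ≤ lam) (hr : 1 ≤ r) (hE : 1 ≤ E) (hmp : m ^ 2 ≤ p) (hp : p ≤ C)
    (hb : |b| ≤ C) (hu : u = -(r * lam * E) * p) (hk : |k| ≤ C * ((r * lam * E) ^ 2 * p)) :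
    3 / 4 * m ^ 4 * (lam ^ 4 * r ^ 3 * E ^ 3)
      ≤ -2 * (-(r * E) * (lam ^ 2 * (u * u) + lam * k))
        + (r * lam * E) ^ 2 * p * (-(r * E) * (lam ^ 2 * p + lam * b)) := by
  have hp₀ : 0 ≤ p := (sq_nonneg m).trans hmp
  have hC : 0 ≤ C := hp₀.trans hp
  rw [div_le_iff₀ (by positivity)] at hlam'
  have h₁ : -(C * ((r * lam * E) ^ 2 * C)) ≤ k := by
    refine le_trans ?_ (neg_le_of_abs_le hk)
    gcongr
  have h₂ : p * b ≤ C * C := (le_abs_self _).trans (by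
    rw [abs_mul, abs_of_nonneg hp₀]
    gcongr)
  have h₃ : m ^ 4 ≤ p ^ 2 := by
    calc m ^ 4 = (m ^ 2) ^ 2 := by ring
      _ ≤ p ^ 2 := by gcongr
  have h₄ := mul_le_mul_of_nonneg_left h₁ (show 0 ≤ 2 * (r * E) * lam by positivity)
  have h₅ := mul_le_mul_of_nonneg_left h₂ (show 0 ≤ r ^ 3 * E ^ 3 * lam ^ 3 by positivity)
  have h₆ := mul_le_mul_of_nonneg_left h₃ (show 0 ≤ r ^ 3 * E ^ 3 * lam ^ 4 by positivity)
  have h₇ := mul_le_mul_of_nonneg_left hlam' (show 0 ≤ r ^ 3 * E ^ 3 * lam ^ 3 by positivity)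
  subst hu
  linarith

theorem first_order_term_lower_bound {v φ T s s₀ : ℝ} (hlam : 1 ≤ lam) (hr : 1 ≤ r) (hE : 1 ≤ E)
    (hp₀ : 0 ≤ p) (hp : p ≤ C) (hb : |b| ≤ C) (hφ₀ : 0 ≤ φ) (hφ : φ ≤ E ^ 2) (hT : 0 < T)
    (hs₀ : 0 < s₀) (hsT : s₀ ≤ s * T) (hs : 0 < s) (hv : |v| ≤ 4 * r ^ 2 / T) :
    -(20 * C / s₀ * (lam ^ 4 * r ^ 3 * E ^ 3))
      ≤ 1 / s * ((v * r * lam ^ 2 * E ^ 2 * p + v * φ * (-(r * E) * (lam ^ 2 * p + lam * b)))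
        - 2 * (v * φ) * (-(r * E) * (lam ^ 2 * p + lam * b))
        + 2 * r * v * (lam * E) ^ 2 * p) := by
  have hC : 0 ≤ C := hp₀.trans hp
  have hL := abs_lapl_factor_le hlam hp₀ hp hb
  set L := lam ^ 2 * p + lam * b
  have hbr : |3 * r * lam ^ 2 * E ^ 2 * p + φ * r * E * L| ≤ 5 * C * (lam ^ 4 * r * E ^ 3) := by
    have hEE : E ^ 2 ≤ E ^ 3 := by gcongr; norm_num
    have hll : lam ^ 2 ≤ lam ^ 4 := by gcongr; norm_num
    calc |3 * r * lam ^ 2 * E ^ 2 * p + φ * r * E * L|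
        ≤ |3 * r * lam ^ 2 * E ^ 2 * p| + |φ * r * E * L| := abs_add_le _ _
      _ = 3 * r * lam ^ 2 * E ^ 2 * p + φ * r * E * |L| := by
        rw [abs_of_nonneg (by positivity), abs_mul, abs_of_nonneg (by positivity : 0 ≤ φ * r * E)]
      _ ≤ 3 * r * lam ^ 4 * E ^ 3 * C + E ^ 2 * r * E * (2 * C * lam ^ 4) := by
        have hL' : |L| ≤ 2 * C * lam ^ 4 := hL.trans (by gcongr)
        gcongr
      _ = _ := by ring
  have habs : |1 / s * (v * (3 * r * lam ^ 2 * E ^ 2 * p + φ * r * E * L))|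
      ≤ 20 * C / s₀ * (lam ^ 4 * r ^ 3 * E ^ 3) := by
    rw [abs_mul, abs_mul, abs_of_pos (by positivity : 0 < 1 / s)]
    calc 1 / s * (|v| * |3 * r * lam ^ 2 * E ^ 2 * p + φ * r * E * L|)
        ≤ 1 / s * (4 * r ^ 2 / T * (5 * C * (lam ^ 4 * r * E ^ 3))) := by gcongr
      _ = 20 * C / (s * T) * (lam ^ 4 * r ^ 3 * E ^ 3) := by
        field_simp
        ring
      _ ≤ _ := by gcongr
  refine (neg_le_of_abs_le habs).trans (le_of_eq ?_)
  ring

theorem second_order_term_lower_bound {v φ T s s₀ d₁ d₂ l₁ l₂ : ℝ} (hlam : 1 ≤ lam) (hr : 1 ≤ r)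
    (hE : 1 ≤ E) (hC : 1 ≤ C) (hp₀ : 0 ≤ p) (hp : p ≤ C) (hb : |b| ≤ C) (hφ₀ : 0 ≤ φ)
    (hφ : φ ≤ E ^ 2) (hT : 0 < T) (hs₀ : 1 ≤ s₀) (hsT : s₀ ≤ s * T) (hs : s₀ ≤ s)
    (hv : |v| ≤ 40 * r ^ 3 / T ^ 2) (hd₁ : |d₁| ≤ C) (hd₂ : |d₂| ≤ C) (hl₁ : |l₁| ≤ C)
    (hl₂ : |l₂| ≤ C) :
    -((20 + 10 * C ^ 2) / s₀ * (lam ^ 4 * r ^ 3 * E ^ 3))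
      ≤ -(1 / (2 * s ^ 2) * (v * φ - 2 * (-(r * E) * ((lam ^ 2 * p + lam * b) ^ 2
        + 2 * lam * (lam ^ 2 * d₁ + lam * d₂) + (lam ^ 2 * l₁ + lam * l₂))))) := by
  have hL := abs_lapl_factor_le hlam hp₀ hp hb
  set L := lam ^ 2 * p + lam * b
  have hs' : 0 < s := by linarith
  have hl2 : lam ^ 2 ≤ lam ^ 4 := by gcongr; norm_num
  have hl3 : lam ^ 3 ≤ lam ^ 4 := by gcongr; norm_num
  have hl1 : lam ≤ lam ^ 4 := by
    calc lam = lam ^ 1 := by ring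
      _ ≤ lam ^ 4 := by gcongr; norm_num
  have bound : ∀ {y a : ℝ}, 0 ≤ y → y ≤ lam ^ 4 → |a| ≤ C → y * a ≤ C * lam ^ 4 := by
    intro y a hy hy' ha
    calc y * a ≤ y * C := mul_le_mul_of_nonneg_left (le_of_abs_le ha) hy
      _ ≤ lam ^ 4 * C := by gcongr
      _ = _ := by ring
  have hQ : L ^ 2 + 2 * lam * (lam ^ 2 * d₁ + lam * d₂) + (lam ^ 2 * l₁ + lam * l₂)
      ≤ 10 * C ^ 2 * lam ^ 4 := by
    have hL2 : L ^ 2 ≤ (2 * C * lam ^ 2) ^ 2 := sq_le_sq' (neg_le_of_abs_le hL) (le_of_abs_le hL)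
    have e₁ := bound (by positivity) hl3 hd₁
    have e₂ := bound (by positivity) hl2 hd₂
    have e₃ := bound (by positivity) hl2 hl₁
    have e₄ := bound (by positivity) hl1 hl₂
    have hCC : C * lam ^ 4 ≤ C ^ 2 * lam ^ 4 := by
      gcongr
      nlinarith
    linarith
  have hrE : r * E ≤ r ^ 3 * E ^ 3 := by
    have h₁ : r ^ 1 ≤ r ^ 3 := by gcongr; norm_num
    have h₂ : E ^ 1 ≤ E ^ 3 := by gcongr; norm_num
    rw [pow_one] at h₁ h₂
    gcongr
  have hss : s₀ ≤ s ^ 2 := by nlinarith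
  have hssT : s₀ ≤ (s * T) ^ 2 := by nlinarith
  have h₁ : 1 / (2 * s ^ 2) * (v * φ) ≤ 20 / s₀ * (lam ^ 4 * r ^ 3 * E ^ 3) := by
    calc 1 / (2 * s ^ 2) * (v * φ) ≤ 1 / (2 * s ^ 2) * (40 * r ^ 3 / T ^ 2 * E ^ 3) := by
          have hφ' : φ ≤ E ^ 3 := hφ.trans (by gcongr; norm_num)
          have hv' := le_of_abs_le hv
          gcongr
      _ = 20 / (s * T) ^ 2 * (1 * r ^ 3 * E ^ 3) := by
        field_simp
        ring
      _ ≤ _ := by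
        have : 1 ≤ lam ^ 4 := one_le_pow₀ hlam
        gcongr
  have h₂ : 1 / s ^ 2 * (r * E * (L ^ 2 + 2 * lam * (lam ^ 2 * d₁ + lam * d₂)
      + (lam ^ 2 * l₁ + lam * l₂))) ≤ 10 * C ^ 2 / s₀ * (lam ^ 4 * r ^ 3 * E ^ 3) := by
    calc _ ≤ 1 / s ^ 2 * (r * E * (10 * C ^ 2 * lam ^ 4)) := by gcongr
      _ ≤ 1 / s₀ * (r ^ 3 * E ^ 3 * (10 * C ^ 2 * lam ^ 4)) := by gcongr
      _ = _ := by ring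
  have h₃ : 1 / (2 * s ^ 2) * (v * φ - 2 * (-(r * E) * (L ^ 2
        + 2 * lam * (lam ^ 2 * d₁ + lam * d₂) + (lam ^ 2 * l₁ + lam * l₂))))
      = 1 / (2 * s ^ 2) * (v * φ) + 1 / s ^ 2 * (r * E * (L ^ 2
        + 2 * lam * (lam ^ 2 * d₁ + lam * d₂) + (lam ^ 2 * l₁ + lam * l₂))) := by
    field_simp
    ring
  rw [h₃]
  have h₄ : (20 + 10 * C ^ 2) / s₀ * (lam ^ 4 * r ^ 3 * E ^ 3)
      = 20 / s₀ * (lam ^ 4 * r ^ 3 * E ^ 3)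
        + 10 * C ^ 2 / s₀ * (lam ^ 4 * r ^ 3 * E ^ 3) := by ring
  linarith

end RealEstimates

/-- Lower bounds for the Carleman coefficients `G₂` and `H` associated with
the weight `φ̂(t,x) = ϖ(t) φ(x)`, where `ϖ(t) = (4 (t/T)(1−t/T))⁻¹`,
`η = exp(λ(ψ + 2‖ψ‖_∞))` and `φ = exp(4λ‖ψ‖_∞) − η`: there are `λ₀, s₀ ≥ 1` and `c > 0`,
depending only on `ψ` and `c_ψ` (not on `T`), such that for every `T > 0`, `λ ≥ λ₀`,
`s ≥ (1 + 1/T) s₀`, every `(t,x) ∈ (0,T) × Ω` and every `ξ ∈ ℝ^d`,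
`G₂ ≥ c λ⁴ ϖ³ η³` and `H(ξ) ≥ c λ² ϖ η ‖ξ‖²`. -/
theorem statement5
    (n : ℕ) (hn : 1 ≤ n) (Ω : Set (EuclideanSpace ℝ (Fin n)))
    (hΩo : IsOpen Ω) (hΩb : Bornology.IsBounded Ω)
    (ψ : EuclideanSpace ℝ (Fin n) → ℝ)
    (hψsmooth : ContDiffOn ℝ (⊤ : ℕ∞) ψ (closure Ω))
    (hψnonneg : ∀ x ∈ closure Ω, 0 ≤ ψ x)
    (cψ : ℝ) (hcψ : 0 < cψ)
    (hψgrad : ∀ x ∈ closure Ω, cψ ≤ ‖gradient ψ x‖)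
    (M : ℝ) (hM : M = sSup (ψ '' closure Ω)) :
    ∃ lam₀ : ℝ, 1 ≤ lam₀ ∧ ∃ s₀ : ℝ, 1 ≤ s₀ ∧ ∃ c : ℝ, 0 < c ∧
      ∀ T : ℝ, 0 < T → ∀ lam : ℝ, lam₀ ≤ lam → ∀ s : ℝ, (1 + 1 / T) * s₀ ≤ s →
      ∀ t ∈ Ioo (0:ℝ) T, ∀ x ∈ Ω, ∀ ξ : EuclideanSpace ℝ (Fin n),
        let ϖ : ℝ → ℝ := fun t' => 1 / (4 * (t' / T) * (1 - t' / T))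
        let η : EuclideanSpace ℝ (Fin n) → ℝ := fun x' => Real.exp (lam * (ψ x' + 2 * M))
        let φ : EuclideanSpace ℝ (Fin n) → ℝ := fun x' => Real.exp (4 * lam * M) - η x'
        let Φ : ℝ → EuclideanSpace ℝ (Fin n) → ℝ := fun t' x' => ϖ t' * φ x'
        let dtΦ : ℝ → EuclideanSpace ℝ (Fin n) → ℝ := fun t' x' => deriv (fun s' => Φ s' x') t'
        let G₂ : ℝ :=
          -2 * hess2 (Φ t) x (gradient (Φ t) x) (gradient (Φ t) x)
            + ‖gradient (Φ t) x‖ ^ 2 * lapl (Φ t) x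
            + (1 / s) * (divg (fun z => dtΦ t z • gradient (Φ t) z) x
                - 2 * dtΦ t x * lapl (Φ t) x
                + deriv (fun s' => ‖gradient (Φ s') x‖ ^ 2) t)
            - (1 / (2 * s ^ 2)) * (deriv (fun s' => dtΦ s' x) t
                - 2 * lapl (fun z => lapl (Φ t) z) x)
        let H : ℝ := -2 * hess2 (Φ t) x ξ ξ - lapl (Φ t) x * ‖ξ‖ ^ 2
        c * lam ^ 4 * (ϖ t) ^ 3 * (η x) ^ 3 ≤ G₂ ∧
          c * lam ^ 2 * ϖ t * η x * ‖ξ‖ ^ 2 ≤ H := by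
  have hK : IsCompact (closure Ω) := hΩb.isCompact_closure
  have hψ : SmoothBoundedOn ψ Ω :=
    SmoothBoundedOn.of_isCompact hΩo subset_closure hK hψsmooth
  have hψM : ∀ x ∈ Ω, ψ x ≤ M := fun x hx => by
    rw [hM]
    exact le_csSup (hK.bddAbove_image hψsmooth.continuousOn)
      (mem_image_of_mem _ (subset_closure hx))
  have hP := hψ.gradDot hψ hΩo
  have hB := hψ.lapl hΩo
  obtain ⟨C₁, hC₁⟩ := hP.exists_norm_le
  obtain ⟨C₂, hC₂⟩ := hB.exists_norm_le
  obtain ⟨C₃, hC₃⟩ := hψ.exists_hess2_le hΩo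
  obtain ⟨C₄, hC₄⟩ := (hψ.gradDot hP hΩo).exists_norm_le
  obtain ⟨C₅, hC₅⟩ := (hψ.gradDot hB hΩo).exists_norm_le
  obtain ⟨C₆, hC₆⟩ := (hP.lapl hΩo).exists_norm_le
  obtain ⟨C₇, hC₇⟩ := (hB.lapl hΩo).exists_norm_le
  simp only [Real.norm_eq_abs] at hC₁ hC₂ hC₄ hC₅ hC₆ hC₇
  obtain ⟨C, hC⟩ := ({1, C₁, C₂, C₃, C₄, C₅, C₆, C₇} : Finset ℝ).bddAbove
  simp only [mem_upperBounds, Finset.coe_insert, Finset.coe_singleton, mem_insert_iff,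
    mem_singleton_iff, forall_eq_or_imp, forall_eq] at hC
  obtain ⟨hC, h₁, h₂, h₃, h₄, h₅, h₆, h₇⟩ := hC
  refine ⟨1 + 12 * C ^ 2 / cψ ^ 4 + 6 * C / cψ ^ 2, ?_,
    1 + 4 * (20 * C + (20 + 10 * C ^ 2)) / cψ ^ 4, ?_,
    min (cψ ^ 4 / 2) (cψ ^ 2 / 2), by positivity, ?_⟩
  · have : 0 ≤ 12 * C ^ 2 / cψ ^ 4 + 6 * C / cψ ^ 2 := by positivity
    linarith
  · have : 0 ≤ 4 * (20 * C + (20 + 10 * C ^ 2)) / cψ ^ 4 := by positivity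
    linarith
  intro T hT lam hlam s hs t ht x hx ξ ϖ η φ Φ dtΦ G₂ H
  set s₀ := 1 + 4 * (20 * C + (20 + 10 * C ^ 2)) / cψ ^ 4 with hs₀
  have hs₀1 : 1 ≤ s₀ := by
    have : 0 ≤ 4 * (20 * C + (20 + 10 * C ^ 2)) / cψ ^ 4 := by positivity
    linarith
  have hlamA : 0 ≤ 12 * C ^ 2 / cψ ^ 4 := by positivity
  have hlamB : 0 ≤ 6 * C / cψ ^ 2 := by positivity
  have hlam1 : 1 ≤ lam := by linarith
  have hss₀ : s₀ ≤ s := by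
    have : 0 ≤ 1 / T * s₀ := by positivity
    linarith
  have hsT : s₀ ≤ s * T := by
    have h := mul_le_mul_of_nonneg_right hs hT.le
    have e : (1 + 1 / T) * s₀ * T = s₀ * T + s₀ := by field_simp
    have : 0 ≤ s₀ * T := by positivity
    linarith
  have hr : 1 ≤ ϖ t := one_le_timeFactor ht
  have hv : |deriv ϖ t| ≤ 4 * ϖ t ^ 2 / T := abs_deriv_timeFactor_le ht
  have hv₂ : |deriv (fun s' => deriv ϖ s') t| ≤ 40 * ϖ t ^ 3 / T ^ 2 :=
    abs_deriv_deriv_timeFactor_le ht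
  have hd : HasDerivAt ϖ (deriv ϖ t) t :=
    (hasDerivAt_timeFactor ht).differentiableAt.hasDerivAt
  have hψ0 := hψnonneg x (subset_closure hx)
  have hψ1 := hψM x hx
  have hη : 1 ≤ η x := Real.one_le_exp (by nlinarith)
  have hφ0 : 0 ≤ φ x := sub_nonneg.2 (Real.exp_le_exp.2 (by nlinarith))
  have hφ1 : φ x ≤ η x ^ 2 := by
    have h : Real.exp (4 * lam * M) ≤ η x ^ 2 := by
      rw [← Real.exp_nat_mul]
      exact Real.exp_le_exp.2 (by push_cast; nlinarith)
    have : φ x = Real.exp (4 * lam * M) - η x := rfl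
    linarith
  have hp₁ : cψ ^ 2 ≤ gradDot ψ ψ x := by
    rw [gradDot_self]
    have := hψgrad x (subset_closure hx)
    gcongr
  have hp₂ : gradDot ψ ψ x ≤ C := (le_of_abs_le (hC₁ x hx)).trans h₁
  have hp₀ : 0 ≤ gradDot ψ ψ x := (sq_nonneg _).trans hp₁
  have hb : |lapl ψ x| ≤ C := (hC₂ x hx).trans h₂
  have hhess : ∀ ξ, |hess2 ψ x ξ ξ| ≤ C * ‖ξ‖ ^ 2 := fun ξ =>
    (hC₃ x hx ξ).trans (by gcongr)
  have hdiff := hψ.differentiableAt hΩo hx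
  set K := Real.exp (4 * lam * M)
  have hΦ : ∀ t', Φ t' = weight ψ lam (2 * M) K (ϖ t') := fun _ => rfl
  have hdt : ∀ t', dtΦ t' = weight ψ lam (2 * M) K (deriv ϖ t') := fun t' => by
    funext z
    exact deriv_mul_const_field (φ z)
  have hgrad : ∀ t', gradient (Φ t') x = (-(ϖ t' * lam * η x)) • gradient ψ x := fun t' => by
    rw [hΦ]
    exact gradient_weight hdiff lam (2 * M) K (ϖ t')
  have hgradsq : ∀ t', ‖gradient (Φ t') x‖ ^ 2 = (ϖ t' * lam * η x) ^ 2 * gradDot ψ ψ x :=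
    fun t' => by
      rw [hgrad, norm_smul, mul_pow, gradDot_self, Real.norm_eq_abs, sq_abs, neg_sq]
  have hhessΦ : ∀ ζ, hess2 (Φ t) x ζ ζ
      = -(ϖ t * η x) * (lam ^ 2 * (fderiv ℝ ψ x ζ * fderiv ℝ ψ x ζ) + lam * hess2 ψ x ζ ζ) :=
    fun ζ => by
      rw [hΦ]
      exact hess2_weight hΩo hψ hx lam (2 * M) K (ϖ t) ζ ζ
  have hlapl : lapl (Φ t) x
      = -(ϖ t * η x) * (lam ^ 2 * gradDot ψ ψ x + lam * lapl ψ x) := by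
    rw [hΦ]
    exact lapl_weight hΩo hψ hx lam (2 * M) K (ϖ t)
  have hbilapl : lapl (fun z => lapl (Φ t) z) x
      = -(ϖ t * η x) * ((lam ^ 2 * gradDot ψ ψ x + lam * lapl ψ x) ^ 2
        + 2 * lam * (lam ^ 2 * gradDot ψ (gradDot ψ ψ) x + lam * gradDot ψ (lapl ψ) x)
        + (lam ^ 2 * lapl (gradDot ψ ψ) x + lam * lapl (lapl ψ) x)) := by
    rw [hΦ]
    exact lapl_lapl_weight hΩo hψ hx lam (2 * M) K (ϖ t)
  have hdivg : divg (fun z => dtΦ t z • gradient (Φ t) z) x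
      = deriv ϖ t * ϖ t * lam ^ 2 * η x ^ 2 * gradDot ψ ψ x
        + deriv ϖ t * φ x * (-(ϖ t * η x) * (lam ^ 2 * gradDot ψ ψ x + lam * lapl ψ x)) := by
    rw [← hlapl, hdt, hΦ]
    exact divg_weight hΩo hψ hx lam (2 * M) K (ϖ t) (deriv ϖ t)
  have hdtx : dtΦ t x = deriv ϖ t * φ x := by rw [hdt]; rfl
  have hdtsq : deriv (fun s' => ‖gradient (Φ s') x‖ ^ 2) t
      = 2 * ϖ t * deriv ϖ t * (lam * η x) ^ 2 * gradDot ψ ψ x := by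
    have hfun : (fun s' => ‖gradient (Φ s') x‖ ^ 2)
        = fun s' => (ϖ s') ^ 2 * ((lam * η x) ^ 2 * gradDot ψ ψ x) := by
      funext s'
      rw [hgradsq]
      ring
    rw [hfun, ((hd.fun_pow 2).mul_const _).deriv]
    push_cast
    ring
  have hdtt : deriv (fun s' => dtΦ s' x) t = deriv (fun s' => deriv ϖ s') t * φ x := by
    have hfun : (fun s' => dtΦ s' x) = fun s' => deriv ϖ s' * φ x := by
      funext s'
      rw [hdt]
      rfl
    rw [hfun, deriv_mul_const_field]
  constructor
  · have hu : fderiv ℝ ψ x (gradient (Φ t) x)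
        = -(ϖ t * lam * η x) * gradDot ψ ψ x := by
      rw [hgrad, map_smul, smul_eq_mul, ← inner_gradient_left, real_inner_self_eq_norm_sq,
        gradDot_self]
    have hk : |hess2 ψ x (gradient (Φ t) x) (gradient (Φ t) x)|
        ≤ C * ((ϖ t * lam * η x) ^ 2 * gradDot ψ ψ x) :=
      (hhess _).trans_eq (by rw [hgradsq])
    have e₁ := cubic_term_lower_bound hcψ hlam1 (by linarith) hr hη hp₁ hp₂ hb hu hk
    have e₂ := first_order_term_lower_bound hlam1 hr hη hp₀ hp₂ hb hφ0 hφ1 hT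
      (by linarith) hsT (by linarith) hv
    have e₃ := second_order_term_lower_bound hlam1 hr hη hC hp₀ hp₂ hb hφ0 hφ1 hT hs₀1 hsT hss₀
      hv₂ ((hC₄ x hx).trans h₄) ((hC₅ x hx).trans h₅) ((hC₆ x hx).trans h₆)
      ((hC₇ x hx).trans h₇)
    have hG : G₂ = -2 * hess2 (Φ t) x (gradient (Φ t) x) (gradient (Φ t) x)
        + ‖gradient (Φ t) x‖ ^ 2 * lapl (Φ t) x
        + (1 / s) * (divg (fun z => dtΦ t z • gradient (Φ t) z) x
          - 2 * dtΦ t x * lapl (Φ t) x + deriv (fun s' => ‖gradient (Φ s') x‖ ^ 2) t)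
        - (1 / (2 * s ^ 2)) * (deriv (fun s' => dtΦ s' x) t
          - 2 * lapl (fun z => lapl (Φ t) z) x) := rfl
    rw [hhessΦ, hgradsq, hlapl, hdivg, hdtx, hdtsq, hdtt, hbilapl] at hG
    have hY : 0 ≤ lam ^ 4 * ϖ t ^ 3 * η x ^ 3 := by positivity
    have hsmall : 20 * C / s₀ + (20 + 10 * C ^ 2) / s₀ ≤ cψ ^ 4 / 4 := by
      rw [← add_div, div_le_iff₀ (by linarith), hs₀]
      have : cψ ^ 4 / 4 * (1 + 4 * (20 * C + (20 + 10 * C ^ 2)) / cψ ^ 4)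
          = cψ ^ 4 / 4 + (20 * C + (20 + 10 * C ^ 2)) := by field_simp
      rw [this]
      have : 0 < cψ ^ 4 := by positivity
      linarith
    have e₄ := mul_le_mul_of_nonneg_right hsmall hY
    have e₅ := mul_le_mul_of_nonneg_right (min_le_left (cψ ^ 4 / 2) (cψ ^ 2 / 2)) hY
    rw [hG]
    generalize ϖ t = r at *
    generalize η x = E at *
    linarith
  · have e := quadratic_form_lower_bound (u := fderiv ℝ ψ x ξ) hcψ hlam1 (by linarith) hr hη
      (sq_nonneg ‖ξ‖) hp₁ hb (hhess ξ)
    have hH : H = -2 * hess2 (Φ t) x ξ ξ - lapl (Φ t) x * ‖ξ‖ ^ 2 := rfl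
    rw [hH, hhessΦ, hlapl]
    refine le_trans ?_ e
    have := min_le_right (cψ ^ 4 / 2) (cψ ^ 2 / 2)
    gcongr
end

section
/- Let q ∈ (0,1), T' > 0, and f : (0,T'] → (0,∞) with f(t) → 0 as t → 0⁺. Assume the approximate observability estimate f(t) N(S(t)y) ≤ f(qt) N(y) + ∫₀^t ‖B(S(τ)y)‖_U² dτ holds for every y ∈ E and every t ∈ (0,T']. Then for every y ∈ E and every T ∈ (0,T']: N(S(T)y) ≤ (1 / f((1−q)T)) ∫₀^T ‖B(S(t)y)‖_U² dt. -/
open MeasureTheory Set Filter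

/-- Cutting an integral over `(0, t + s]` at `s` and translating the upper part. -/
theorem setIntegral_Ioc_add_right_of_locallyIntegrableOn {g : ℝ → ℝ}
    (hg : LocallyIntegrableOn g (Ici 0)) {s t : ℝ} (hs : 0 ≤ s) (ht : 0 ≤ t) :
    ∫ τ in Ioc (0:ℝ) t, g (τ + s) =
      (∫ τ in Ioc (0:ℝ) (t + s), g τ) - ∫ τ in Ioc (0:ℝ) s, g τ := by
  have hint : ∀ b, 0 ≤ b → IntervalIntegrable g volume 0 b := fun b hb =>
    (intervalIntegrable_iff_integrableOn_Icc_of_le hb).2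
      (hg.integrableOn_compact_subset Icc_subset_Ici_self isCompact_Icc)
  rw [← intervalIntegral.integral_of_le ht, ← intervalIntegral.integral_of_le hs,
    ← intervalIntegral.integral_of_le (add_nonneg ht hs),
    intervalIntegral.integral_comp_add_right,
    intervalIntegral.integral_interval_sub_left (hint _ (add_nonneg ht hs)) (hint _ hs), zero_add]

/-- Abstract Lebeau–Robbiano lemma (Miller): if the approximate
observability estimate `f(t) N(S(t)y) ≤ f(qt) N(y) + ∫₀^t ‖B S(τ) y‖² dτ` holds for all
`t ∈ (0,T']` and `f(t) → 0` as `t → 0⁺`, then the observability inequality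
`N(S(T)y) ≤ (1/f((1−q)T)) ∫₀^T ‖B S(t) y‖² dt` holds for all `T ∈ (0,T']`. -/
theorem statement10
    {E U : Type*} [AddCommGroup E] [Module ℝ E]
    [NormedAddCommGroup U] [NormedSpace ℝ U]
    (S : ℝ → E →ₗ[ℝ] E)
    (hS0 : S 0 = LinearMap.id)
    (hSadd : ∀ s t : ℝ, 0 ≤ s → 0 ≤ t → S (t + s) = (S t).comp (S s))
    (N : E → ℝ) (hN : ∀ y, 0 ≤ N y)
    (B : E →ₗ[ℝ] U)
    (hBloc : ∀ y : E, LocallyIntegrableOn (fun t : ℝ => ‖B (S t y)‖ ^ 2) (Ici 0))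
    (hNbdd : ∀ y : E, ∀ b : ℝ, ∃ M : ℝ, ∀ t ∈ Icc (0:ℝ) b, N (S t y) ≤ M)
    (q : ℝ) (hq : q ∈ Ioo (0:ℝ) 1) (T' : ℝ) (hT' : 0 < T')
    (f : ℝ → ℝ) (hfpos : ∀ t ∈ Ioc (0:ℝ) T', 0 < f t)
    (hf0 : Tendsto f (nhdsWithin 0 (Ioi 0)) (nhds 0))
    (happrox : ∀ y : E, ∀ t ∈ Ioc (0:ℝ) T',
      f t * N (S t y) ≤ f (q * t) * N y + ∫ τ in Ioc (0:ℝ) t, ‖B (S τ y)‖ ^ 2) :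
    ∀ y : E, ∀ T ∈ Ioc (0:ℝ) T',
      N (S T y) ≤ (1 / f ((1 - q) * T)) * ∫ t in Ioc (0:ℝ) T, ‖B (S t y)‖ ^ 2 := by
  intro y T ⟨hT0, hTT'⟩
  obtain ⟨hq0, hq1⟩ := hq
  set F : ℝ → ℝ := fun s => ∫ t in Ioc (0:ℝ) s, ‖B (S t y)‖ ^ 2 with hF
  have hF0 : ∀ s, 0 ≤ F s := fun s => integral_nonneg fun t => sq_nonneg _
  set r : ℝ := (1 - q) * T with hr
  have hr0 : 0 < r := mul_pos (by linarith) hT0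
  have hrT' : r ≤ T' := by nlinarith
  have hpow : ∀ n : ℕ, 0 < q ^ n := fun n => pow_pos hq0 n
  have hpow1 : ∀ n : ℕ, q ^ n ≤ 1 := fun n => pow_le_one₀ hq0.le hq1.le
  have hstep : ∀ s t : ℝ, 0 ≤ s → t ∈ Ioc (0:ℝ) T' →
      f t * N (S (t + s) y) ≤ f (q * t) * N (S s y) + (F (t + s) - F s) := by
    intro s t hs ht
    have h := happrox (S s y) t ht
    have heq : ∫ τ in Ioc (0:ℝ) t, ‖B (S τ (S s y))‖ ^ 2 = F (t + s) - F s := by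
      rw [hF, ← setIntegral_Ioc_add_right_of_locallyIntegrableOn (hBloc y) hs ht.1.le]
      refine setIntegral_congr_fun measurableSet_Ioc fun τ hτ => ?_
      simp [hSadd s τ hs hτ.1.le]
    rwa [heq, ← LinearMap.comp_apply, ← hSadd s t hs ht.1.le] at h
  have htel : ∀ n : ℕ, f r * N (S T y) ≤
      f (q ^ n * r) * N (S (q ^ n * T) y) + (F T - F (q ^ n * T)) := by
    intro n
    induction n with
    | zero => simp
    | succ n ih =>
      have h := hstep (q ^ (n + 1) * T) (q ^ n * r) (mul_pos (hpow _) hT0).le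
        ⟨mul_pos (hpow n) hr0, by nlinarith [hpow1 n]⟩
      rw [show q ^ n * r + q ^ (n + 1) * T = q ^ n * T by rw [hr]; ring,
        show q * (q ^ n * r) = q ^ (n + 1) * r by ring] at h
      linarith
  obtain ⟨M, hM⟩ := hNbdd y T
  have hbound : ∀ n : ℕ, f r * N (S T y) ≤ f (q ^ n * r) * M + F T := by
    intro n
    have hs : q ^ n * T ∈ Icc (0:ℝ) T := ⟨(mul_pos (hpow n) hT0).le, by nlinarith [hpow1 n]⟩
    have hf : 0 < f (q ^ n * r) := hfpos _ ⟨mul_pos (hpow n) hr0, by nlinarith [hpow1 n]⟩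
    have h := mul_le_mul_of_nonneg_left (hM _ hs) hf.le
    linarith [htel n, hF0 (q ^ n * T)]
  have hlim : Tendsto (fun n : ℕ => q ^ n * r) atTop (nhdsWithin 0 (Ioi 0)) := by
    refine tendsto_nhdsWithin_iff.2 ⟨?_, Eventually.of_forall fun n => mul_pos (hpow n) hr0⟩
    simpa using (tendsto_pow_atTop_nhds_zero_of_lt_one hq0.le hq1).mul_const r
  have hmain : f r * N (S T y) ≤ F T := by
    have h := ((hf0.comp hlim).mul_const M).add_const (F T)
    rw [zero_mul, zero_add] at h
    exact ge_of_tendsto' h hbound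
  rw [one_div, inv_mul_eq_div, le_div_iff₀ (hfpos r ⟨hr0, hrT'⟩), mul_comm]
  exact hmain
end

section
/- Let T_max > 0, f₀ > 0, g₀ > 0, β > 0 and s₂ > s₁ > 0, and set f(T) = f₀ exp(−2/(s₂ T)^β) and g(T) = g₀ exp(−2/(s₁ T)^β). Assume that f(T) N(S(T)y) ≤ g(T) N(y) + ∫₀^T ‖B(S(t)y)‖_U² dt for every y ∈ E and every T ∈ (0,T_max]. Set s = s₂ (1 − (s₁/s₂)^{β/(β+1)}), and T' = T_max if g₀ ≤ f₀, while T' = ( 2(1 − (s₁/s₂)^{β/(β+1)}) / ( s₁^β · log(g₀/f₀) ) )^{1/β} if g₀ > f₀. Then for every y ∈ E and every T ∈ (0, min(T', T_max)]: N(S(T)y) ≤ (1/f₀) exp( 2/(sT)^β ) ∫₀^T ‖B(S(t)y)‖_U² dt. -/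
open MeasureTheory Set Filter

lemma exp_neg_two_div_le {x : ℝ} (hx : 0 < x) : Real.exp (-2 / x) ≤ x := by
  have h1 : 2 / x + 1 ≤ Real.exp (2 / x) := Real.add_one_le_exp _
  have h2 : x⁻¹ ≤ Real.exp (2 / x) := by
    have : 0 < x⁻¹ := inv_pos.2 hx
    rw [div_eq_mul_inv] at h1 ⊢
    linarith
  rw [neg_div, Real.exp_neg]
  exact inv_le_of_inv_le₀ hx h2

/-- With `q = (s₁/s₂)^(β/(β+1))`, the decay rate of `g` at `τ` beats that of `f` at `q τ`. -/
lemma exp_rate_comparison {f₀ g₀ β s₁ s₂ q τ : ℝ} (hf₀ : 0 < f₀) (hg₀ : 0 < g₀) (hβ : 0 < β)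
    (hs₁ : 0 < s₁) (hs₂ : 0 < s₂) (hτ : 0 < τ) (hq : q = (s₁ / s₂) ^ (β / (β + 1)))
    (hlog : (s₁ * τ) ^ β * Real.log (g₀ / f₀) ≤ 2 * (1 - q)) :
    g₀ * Real.exp (-2 / (s₁ * τ) ^ β) ≤ f₀ * Real.exp (-2 / (s₂ * (q * τ)) ^ β) := by
  have hq0 : 0 < q := by rw [hq]; positivity
  have hqpow : q ^ β * q = (s₁ / s₂) ^ β := by
    rw [← Real.rpow_add_one hq0.ne', hq, ← Real.rpow_mul (by positivity)]
    congr 1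
    field_simp
  have hkey : (s₂ * (q * τ)) ^ β * q = (s₁ * τ) ^ β := by
    rw [Real.mul_rpow hs₂.le (by positivity), Real.mul_rpow hq0.le hτ.le,
      Real.mul_rpow hs₁.le hτ.le]
    rw [Real.div_rpow hs₁.le hs₂.le] at hqpow
    have : 0 < s₂ ^ β := by positivity
    rw [eq_div_iff this.ne'] at hqpow
    rw [← hqpow]
    ring
  have hA : 0 < (s₁ * τ) ^ β := by positivity
  have hB : 0 < (s₂ * (q * τ)) ^ β := by positivity
  have hexp : Real.log (g₀ / f₀) ≤ -2 / (s₂ * (q * τ)) ^ β - -2 / (s₁ * τ) ^ β := by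
    rw [mul_comm, ← le_div_iff₀ hA] at hlog
    refine hlog.trans (le_of_eq ?_)
    rw [← hkey]
    field_simp
    ring
  have h := Real.exp_le_exp.2 hexp
  rw [Real.exp_log (by positivity), Real.exp_sub, div_le_div_iff₀ hf₀ (Real.exp_pos _)] at h
  linarith

/-- A one-step estimate between `q t` and `t` telescopes along the points `qⁿ T` to a bound of the
value at `T` by the integral over `(0, T]`. -/
lemma telescoping_geometric_bound {a F G h : ℝ → ℝ} {q T : ℝ} (hq0 : 0 < q) (hq1 : q < 1)
    (hT : 0 < T) (ha : ∀ t, 0 ≤ a t) (hh : ∀ t, 0 ≤ h t)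
    (hint : ∀ b c, 0 ≤ b → b ≤ c → IntervalIntegrable h volume b c)
    (hstep : ∀ t ∈ Ioc 0 T, F ((1 - q) * t) * a t ≤
      G ((1 - q) * t) * a (q * t) + ∫ r in (q * t)..t, h r)
    (hGF : ∀ t ∈ Ioc 0 T, G ((1 - q) * t) ≤ F ((1 - q) * (q * t)))
    {M : ℝ} (hM : ∀ t ∈ Icc 0 T, a t ≤ M)
    {K : ℝ → ℝ} (hK0 : ∀ t ∈ Ioc 0 T, 0 ≤ K t) (hFK : ∀ t ∈ Ioc 0 T, F ((1 - q) * t) ≤ K t)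
    (hK : Tendsto (fun n : ℕ => K (q ^ n * T)) atTop (nhds 0)) :
    F ((1 - q) * T) * a T ≤ ∫ r in Ioc 0 T, h r := by
  have hmem : ∀ n : ℕ, q ^ n * T ∈ Ioc 0 T := fun n =>
    ⟨by positivity, mul_le_of_le_one_left hT.le (pow_le_one₀ hq0.le hq1.le)⟩
  have htel : ∀ n : ℕ, F ((1 - q) * T) * a T ≤
      F ((1 - q) * (q ^ n * T)) * a (q ^ n * T) + ∫ r in (q ^ n * T)..T, h r := by
    intro n
    induction n with
    | zero => simp
    | succ n ih =>
      have hle : q * (q ^ n * T) ≤ q ^ n * T := mul_le_of_le_one_left (hmem n).1.le hq1.le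
      have h0 : 0 ≤ q * (q ^ n * T) := mul_nonneg hq0.le (hmem n).1.le
      have hadd := intervalIntegral.integral_add_adjacent_intervals
        (hint _ _ h0 hle) (hint _ _ (hmem n).1.le (hmem n).2)
      have h1 := hstep _ (hmem n)
      have h2 := mul_le_mul_of_nonneg_right (hGF _ (hmem n)) (ha (q * (q ^ n * T)))
      rw [pow_succ', mul_assoc]
      linarith
  have hlim : Tendsto (fun n : ℕ => K (q ^ n * T) * M + ∫ r in (0 : ℝ)..T, h r) atTop
      (nhds (∫ r in (0 : ℝ)..T, h r)) := by
    simpa using (hK.mul_const M).add_const (∫ r in (0 : ℝ)..T, h r)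
  rw [← intervalIntegral.integral_of_le hT.le]
  refine ge_of_tendsto' hlim fun n => (htel n).trans (add_le_add ?_ ?_)
  · exact mul_le_mul (hFK _ (hmem n)) (hM _ ⟨(hmem n).1.le, (hmem n).2⟩) (ha _) (hK0 _ (hmem n))
  · have hadd := intervalIntegral.integral_add_adjacent_intervals
      (hint _ _ le_rfl (hmem n).1.le) (hint _ _ (hmem n).1.le (hmem n).2)
    have := intervalIntegral.integral_nonneg (μ := volume) (hmem n).1.le (fun u _ => hh u)
    linarith

/-- Quantitative version of the abstract Lebeau–Robbiano lemma: if
`f(T) N(S(T)y) ≤ g(T) N(y) + ∫₀^T ‖B S(t) y‖² dt` on `(0,T_max]`, with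
`f(T) = f₀ exp(−2/(s₂T)^β)` and `g(T) = g₀ exp(−2/(s₁T)^β)`, `s₂ > s₁ > 0`, then setting
`s = s₂(1 − (s₁/s₂)^{β/(β+1)})` and an explicit `T'`, observability holds on
`(0, min(T',T_max)]` with cost `(1/f₀) exp(2/(sT)^β)`. -/
theorem statement11
    {E U : Type*} [AddCommGroup E] [Module ℝ E]
    [NormedAddCommGroup U] [NormedSpace ℝ U]
    (S : ℝ → E →ₗ[ℝ] E)
    (hS0 : S 0 = LinearMap.id)
    (hSadd : ∀ s t : ℝ, 0 ≤ s → 0 ≤ t → S (t + s) = (S t).comp (S s))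
    (N : E → ℝ) (hN : ∀ y, 0 ≤ N y)
    (B : E →ₗ[ℝ] U)
    (hBloc : ∀ y : E, LocallyIntegrableOn (fun t : ℝ => ‖B (S t y)‖ ^ 2) (Ici 0))
    (hNbdd : ∀ y : E, ∀ b : ℝ, ∃ M : ℝ, ∀ t ∈ Icc (0:ℝ) b, N (S t y) ≤ M)
    (Tmax f₀ g₀ β s₁ s₂ : ℝ)
    (hTmax : 0 < Tmax) (hf₀ : 0 < f₀) (hg₀ : 0 < g₀) (hβ : 0 < β)
    (hs₁ : 0 < s₁) (hs₁₂ : s₁ < s₂)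
    (happrox : ∀ y : E, ∀ T ∈ Ioc (0:ℝ) Tmax,
      f₀ * Real.exp (-2 / (s₂ * T) ^ β) * N (S T y) ≤
        g₀ * Real.exp (-2 / (s₁ * T) ^ β) * N y
          + ∫ t in Ioc (0:ℝ) T, ‖B (S t y)‖ ^ 2)
    (s T' : ℝ)
    (hs : s = s₂ * (1 - (s₁ / s₂) ^ (β / (β + 1))))
    (hT' : T' = if g₀ ≤ f₀ then Tmax
      else (2 * (1 - (s₁ / s₂) ^ (β / (β + 1))) / (s₁ ^ β * Real.log (g₀ / f₀))) ^ (1 / β)) :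
    ∀ y : E, ∀ T ∈ Ioc (0:ℝ) (min T' Tmax),
      N (S T y) ≤ (1 / f₀) * Real.exp (2 / (s * T) ^ β) *
        ∫ t in Ioc (0:ℝ) T, ‖B (S t y)‖ ^ 2 := by
  intro y T hT
  obtain ⟨hT0, hTle⟩ := hT
  have hTT' : T ≤ T' := hTle.trans (min_le_left _ _)
  have hTm : T ≤ Tmax := hTle.trans (min_le_right _ _)
  have hs₂ : 0 < s₂ := hs₁.trans hs₁₂
  set q : ℝ := (s₁ / s₂) ^ (β / (β + 1)) with hq
  have hq0 : 0 < q := by positivity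
  have hq1 : q < 1 :=
    Real.rpow_lt_one (by positivity) ((div_lt_one hs₂).2 hs₁₂) (by positivity)
  have h1q : 0 < 1 - q := sub_pos.2 hq1
  have hlog : ∀ τ, 0 < τ → τ ≤ T → (s₁ * τ) ^ β * Real.log (g₀ / f₀) ≤ 2 * (1 - q) := by
    intro τ hτ hτT
    split_ifs at hT' with hgf
    · have : Real.log (g₀ / f₀) ≤ 0 :=
        Real.log_nonpos (by positivity) ((div_le_one hf₀).2 hgf)
      have := mul_nonpos_of_nonneg_of_nonpos (by positivity : 0 ≤ (s₁ * τ) ^ β) this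
      linarith
    · have hL : 0 < Real.log (g₀ / f₀) := Real.log_pos ((one_lt_div hf₀).2 (not_le.1 hgf))
      have hpow : τ ^ β ≤ 2 * (1 - q) / (s₁ ^ β * Real.log (g₀ / f₀)) := by
        refine (Real.rpow_le_rpow hτ.le (hτT.trans hTT') hβ.le).trans (le_of_eq ?_)
        rw [hT', one_div, Real.rpow_inv_rpow (by positivity) hβ.ne']
      rw [le_div_iff₀ (by positivity)] at hpow
      rw [Real.mul_rpow hs₁.le hτ.le]
      linarith
  have hint : ∀ b c, 0 ≤ b → b ≤ c →
      IntervalIntegrable (fun t : ℝ => ‖B (S t y)‖ ^ 2) volume b c := by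
    intro b c hb hbc
    rw [intervalIntegrable_iff_integrableOn_Icc_of_le hbc]
    exact (hBloc y).integrableOn_compact_subset (fun t ht => hb.trans ht.1) isCompact_Icc
  have hτ : ∀ t ∈ Ioc 0 T, 0 < (1 - q) * t ∧ (1 - q) * t ≤ T := fun t ht =>
    ⟨mul_pos h1q ht.1, (mul_le_of_le_one_left ht.1.le (by linarith)).trans ht.2⟩
  obtain ⟨M, hM⟩ := hNbdd y T
  have hmain := telescoping_geometric_bound (a := fun t => N (S t y))
    (F := fun τ => f₀ * Real.exp (-2 / (s₂ * τ) ^ β))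
    (G := fun τ => g₀ * Real.exp (-2 / (s₁ * τ) ^ β))
    (h := fun t => ‖B (S t y)‖ ^ 2) (K := fun t => f₀ * (s₂ * ((1 - q) * t)) ^ β)
    hq0 hq1 hT0 (fun t => hN _) (fun t => by positivity) hint ?_ ?_ hM ?_ ?_ ?_
  · have hsT : s₂ * ((1 - q) * T) = s * T := by rw [hs]; ring
    simp only [hsT] at hmain
    rw [neg_div, Real.exp_neg] at hmain
    have hE := Real.exp_pos (2 / (s * T) ^ β)
    calc N (S T y) = (1 / f₀) * Real.exp (2 / (s * T) ^ β) *
          (f₀ * (Real.exp (2 / (s * T) ^ β))⁻¹ * N (S T y)) := by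
          field_simp
      _ ≤ _ := mul_le_mul_of_nonneg_left hmain (by positivity)
  · intro t ht
    have hqt : 0 ≤ q * t := mul_nonneg hq0.le ht.1.le
    have hsum : (1 - q) * t + q * t = t := by ring
    have h := happrox (S (q * t) y) ((1 - q) * t) ⟨(hτ t ht).1, (hτ t ht).2.trans hTm⟩
    have hcomp : ∀ r, 0 ≤ r → S r (S (q * t) y) = S (r + q * t) y := fun r hr => by
      rw [hSadd _ _ hqt hr, LinearMap.comp_apply]
    have hshift : ∫ r in Ioc 0 ((1 - q) * t), ‖B (S r (S (q * t) y))‖ ^ 2 =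
        ∫ r in (q * t)..t, ‖B (S r y)‖ ^ 2 := by
      rw [setIntegral_congr_fun measurableSet_Ioc
        (fun r hr => by simp only [hcomp r hr.1.le] :
          EqOn _ (fun r => ‖B (S (r + q * t) y)‖ ^ 2) _),
        ← intervalIntegral.integral_of_le (hτ t ht).1.le,
        intervalIntegral.integral_comp_add_right (fun r => ‖B (S r y)‖ ^ 2), hsum, zero_add]
    rwa [hshift, hcomp _ (hτ t ht).1.le, hsum] at h
  · intro t ht
    have h := exp_rate_comparison hf₀ hg₀ hβ hs₁ hs₂ (hτ t ht).1 hq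
      (hlog _ (hτ t ht).1 (hτ t ht).2)
    rwa [mul_left_comm q] at h
  · intro t ht
    have := (hτ t ht).1
    positivity
  · intro t ht
    have := (hτ t ht).1
    exact mul_le_mul_of_nonneg_left (exp_neg_two_div_le (by positivity)) hf₀.le
  · have hcont : Continuous fun x : ℝ => f₀ * (s₂ * ((1 - q) * (x * T))) ^ β :=
      continuous_const.mul ((by fun_prop : Continuous fun x : ℝ =>
        s₂ * ((1 - q) * (x * T))).rpow_const fun _ => Or.inr hβ.le)
    have h := (hcont.tendsto 0).comp (tendsto_pow_atTop_nhds_zero_of_lt_one hq0.le hq1)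
    simpa [Real.zero_rpow hβ.ne', Function.comp_def] using h
end

section
/- For every μ ≥ 0 one has d·μ ≤ ν_μ, and moreover ν_μ − d·μ → 0 as μ → +∞ (equivalently, there exists a continuous function κ : [0,∞) → [0,∞) with κ(μ) → 0 as μ → ∞ such that d·μ ≤ ν_μ ≤ d·μ + κ(μ) for all μ ≥ 0). -/
open MeasureTheory Metric Set Filter

/-- The Rayleigh quotient of the operator `−Δ + μ²‖x‖²` on the ball `B_R`, evaluated at a
function `w`. -/
noncomputable def rayleigh (n : ℕ) (R μ : ℝ) (w : EuclideanSpace ℝ (Fin n) → ℝ) : ℝ :=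
  (∫ x in ball (0 : EuclideanSpace ℝ (Fin n)) R,
      (‖gradient w x‖ ^ 2 + μ ^ 2 * ‖x‖ ^ 2 * (w x) ^ 2)) /
  (∫ x in ball (0 : EuclideanSpace ℝ (Fin n)) R, (w x) ^ 2)

/-- The bottom `ν_μ` of the Rayleigh quotient of `−Δ + μ²‖x‖²` over nonzero smooth
functions compactly supported in `B_R` (the smallest Dirichlet eigenvalue). -/
noncomputable def nuBottom (n : ℕ) (R μ : ℝ) : ℝ :=
  sInf {ν : ℝ | ∃ w : EuclideanSpace ℝ (Fin n) → ℝ,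
    ContDiff ℝ (⊤ : ℕ∞) w ∧ HasCompactSupport w ∧
    tsupport w ⊆ ball (0 : EuclideanSpace ℝ (Fin n)) R ∧ w ≠ 0 ∧ ν = rayleigh n R μ w}

/-- Integration by parts against the radial field: `∫ D(w²)(x) x = -n ∫ w²`. -/
theorem integral_fderiv_sq_apply_self {n : ℕ} {w : EuclideanSpace ℝ (Fin n) → ℝ}
    (hw : ContDiff ℝ 1 w) (hc : HasCompactSupport w) :
    ∫ x, 2 * w x * fderiv ℝ w x x = -(n * ∫ x, w x ^ 2) := by
  have hg : ContDiff ℝ 1 (fun x => w x ^ 2) := hw.pow 2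
  have hgc : HasCompactSupport (fun x => w x ^ 2) := hc.comp_left (g := fun t : ℝ => t ^ 2) (by simp)
  have hg' : Continuous (fderiv ℝ (fun x => w x ^ 2)) := hg.continuous_fderiv one_ne_zero
  have hgc' : HasCompactSupport (fderiv ℝ (fun x => w x ^ 2)) := hgc.fderiv ℝ
  have hfd : ∀ x v, fderiv ℝ (fun x => w x ^ 2) x v = 2 * w x * fderiv ℝ w x v := by
    intro x v
    rw [fderiv_fun_pow 2 (hw.differentiable one_ne_zero x)]
    simp
  have hsum : ∀ x, 2 * w x * fderiv ℝ w x x = ∑ i : Fin n,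
      x i * fderiv ℝ (fun x => w x ^ 2) x (EuclideanSpace.basisFun (Fin n) ℝ i) := by
    intro x
    rw [← hfd]
    conv_lhs => rw [← congrArg (fderiv ℝ (fun x => w x ^ 2) x)
      ((EuclideanSpace.basisFun (Fin n) ℝ).sum_repr x), map_sum]
    simp only [map_smul, smul_eq_mul, EuclideanSpace.basisFun_repr]
  have hcoord : ∀ i : Fin n, Continuous fun x : EuclideanSpace ℝ (Fin n) => x i := by
    intro i; fun_prop
  have hint : ∀ i : Fin n, Integrable (fun x : EuclideanSpace ℝ (Fin n) =>
      x i * fderiv ℝ (fun x => w x ^ 2) x (EuclideanSpace.basisFun (Fin n) ℝ i)) := by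
    intro i
    refine Continuous.integrable_of_hasCompactSupport
      ((hcoord i).mul (hg'.clm_apply continuous_const)) ?_
    exact (hgc'.comp_left (g := fun L : EuclideanSpace ℝ (Fin n) →L[ℝ] ℝ =>
      L (EuclideanSpace.basisFun (Fin n) ℝ i)) (by simp)).mul_left
  have hcd : ∀ (i : Fin n) (x v : EuclideanSpace ℝ (Fin n)),
      fderiv ℝ (fun x : EuclideanSpace ℝ (Fin n) => x i) x v = v i := by
    intro i x v
    exact congrArg (fun L => L v) (EuclideanSpace.proj (𝕜 := ℝ) i).fderiv
  have key : ∀ i : Fin n, ∫ x : EuclideanSpace ℝ (Fin n),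
      x i * fderiv ℝ (fun x => w x ^ 2) x (EuclideanSpace.basisFun (Fin n) ℝ i)
        = -∫ x, w x ^ 2 := by
    intro i
    rw [integral_mul_fderiv_eq_neg_fderiv_mul_of_integrable]
    · simp [hcd]
    · simpa [hcd] using hg.continuous.integrable_of_hasCompactSupport hgc
    · exact hint i
    · exact ((hcoord i).mul hg.continuous).integrable_of_hasCompactSupport hgc.mul_left
    · exact fun x _ => (EuclideanSpace.proj (𝕜 := ℝ) i).differentiable x
    · exact fun x _ => hg.differentiable one_ne_zero x
  simp_rw [hsum]
  rw [integral_finsetSum _ fun i _ => hint i, Finset.sum_congr rfl fun i _ => key i]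
  simp

theorem continuous_gradient {n : ℕ} {w : EuclideanSpace ℝ (Fin n) → ℝ}
    (hw : ContDiff ℝ 1 w) : Continuous (gradient w) :=
  (InnerProductSpace.toDual ℝ (EuclideanSpace ℝ (Fin n))).symm.continuous.comp
    (hw.continuous_fderiv one_ne_zero)

theorem hasCompactSupport_gradient_sq {n : ℕ} {w : EuclideanSpace ℝ (Fin n) → ℝ}
    (hc : HasCompactSupport w) : HasCompactSupport fun x => ‖gradient w x‖ ^ 2 :=
  (hc.fderiv ℝ).comp_left (g := fun L : EuclideanSpace ℝ (Fin n) →L[ℝ] ℝ =>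
    ‖(InnerProductSpace.toDual ℝ (EuclideanSpace ℝ (Fin n))).symm L‖ ^ 2) (by simp)

/-- Completing the square in the energy of the harmonic oscillator. -/
theorem integral_gradient_sq_add_eq {n : ℕ} (μ : ℝ) {w : EuclideanSpace ℝ (Fin n) → ℝ}
    (hw : ContDiff ℝ 1 w) (hc : HasCompactSupport w) :
    ∫ x, (‖gradient w x‖ ^ 2 + μ ^ 2 * ‖x‖ ^ 2 * w x ^ 2)
      = n * μ * (∫ x, w x ^ 2) + ∫ x, ‖gradient w x + (μ * w x) • x‖ ^ 2 := by
  have hgrad : Continuous (gradient w) := continuous_gradient hw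
  have hexp : ∀ x, ‖gradient w x + (μ * w x) • x‖ ^ 2 =
      (‖gradient w x‖ ^ 2 + μ ^ 2 * ‖x‖ ^ 2 * w x ^ 2) + μ * (2 * w x * fderiv ℝ w x x) := by
    intro x
    have h : inner ℝ (gradient w x) x = fderiv ℝ w x x := by
      simp [gradient]
    rw [norm_add_sq_real, inner_smul_right, h, norm_smul, mul_pow, Real.norm_eq_abs, sq_abs]
    ring
  have hI1 : Integrable fun x => ‖gradient w x‖ ^ 2 + μ ^ 2 * ‖x‖ ^ 2 * w x ^ 2 := by
    have hwc := hw.continuous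
    refine Continuous.integrable_of_hasCompactSupport (by fun_prop) ?_
    exact (hasCompactSupport_gradient_sq hc).add
      (hc.comp_left (g := fun t : ℝ => t ^ 2) (by simp)).mul_left
  have hI2 : Integrable fun x => μ * (2 * w x * fderiv ℝ w x x) := by
    refine Continuous.integrable_of_hasCompactSupport (continuous_const.mul
      ((continuous_const.mul hw.continuous).mul
        ((hw.continuous_fderiv one_ne_zero).clm_apply continuous_id))) ?_
    exact (hc.mul_left.mul_right).mul_left
  simp_rw [hexp]
  rw [integral_add hI1 hI2, integral_const_mul, integral_fderiv_sq_apply_self hw hc]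
  ring

theorem integrable_sq {n : ℕ} {w : EuclideanSpace ℝ (Fin n) → ℝ}
    (hw : Continuous w) (hc : HasCompactSupport w) : Integrable fun x => w x ^ 2 :=
  Continuous.integrable_of_hasCompactSupport (by fun_prop)
    (hc.comp_left (g := fun t : ℝ => t ^ 2) (by simp))

theorem integral_sq_pos {n : ℕ} {w : EuclideanSpace ℝ (Fin n) → ℝ}
    (hw : Continuous w) (hc : HasCompactSupport w) (h0 : w ≠ 0) : 0 < ∫ x, w x ^ 2 := by
  obtain ⟨x, hx⟩ := Function.ne_iff.1 h0
  exact (hw.pow 2).integral_pos_of_hasCompactSupport_nonneg_nonzero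
    (hc.comp_left (g := fun t : ℝ => t ^ 2) (by simp)) (fun _ => sq_nonneg _)
    (x := x) (pow_ne_zero 2 hx)

/-- The Rayleigh quotient exceeds `n μ` by a normalized square. -/
theorem rayleigh_eq {n : ℕ} {R : ℝ} (μ : ℝ) {w : EuclideanSpace ℝ (Fin n) → ℝ}
    (hw : ContDiff ℝ 1 w) (hc : HasCompactSupport w)
    (hs : tsupport w ⊆ ball (0 : EuclideanSpace ℝ (Fin n)) R) (h0 : w ≠ 0) :
    rayleigh n R μ w
      = n * μ + (∫ x, ‖gradient w x + (μ * w x) • x‖ ^ 2) / ∫ x, w x ^ 2 := by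
  have hz : ∀ x, x ∉ ball (0 : EuclideanSpace ℝ (Fin n)) R → w x = 0 := fun x hx =>
    image_eq_zero_of_notMem_tsupport fun h => hx (hs h)
  have hz' : ∀ x, x ∉ ball (0 : EuclideanSpace ℝ (Fin n)) R → gradient w x = 0 := by
    intro x hx
    have : fderiv ℝ w x = 0 := by
      by_contra h
      exact hx (hs (support_fderiv_subset ℝ h))
    simp [gradient, this]
  rw [rayleigh, setIntegral_eq_integral_of_forall_compl_eq_zero fun x hx => by
      simp [hz x hx, hz' x hx],
    setIntegral_eq_integral_of_forall_compl_eq_zero fun x hx => by simp [hz x hx],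
    integral_gradient_sq_add_eq μ hw hc]
  have := (integral_sq_pos hw.continuous hc h0).ne'
  field_simp

theorem le_rayleigh {n : ℕ} {R : ℝ} (μ : ℝ) {w : EuclideanSpace ℝ (Fin n) → ℝ}
    (hw : ContDiff ℝ 1 w) (hc : HasCompactSupport w)
    (hs : tsupport w ⊆ ball (0 : EuclideanSpace ℝ (Fin n)) R) (h0 : w ≠ 0) :
    n * μ ≤ rayleigh n R μ w := by
  rw [rayleigh_eq μ hw hc hs h0]
  have : 0 ≤ (∫ x, ‖gradient w x + (μ * w x) • x‖ ^ 2) / ∫ x, w x ^ 2 := by positivity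
  linarith

/-- The ground state of the harmonic oscillator cut off by a function `χ`. -/
noncomputable def cutoffGaussian {n : ℕ} (μ : ℝ) (χ : EuclideanSpace ℝ (Fin n) → ℝ)
    (x : EuclideanSpace ℝ (Fin n)) : ℝ :=
  χ x * Real.exp (-(μ / 2) * ‖x‖ ^ 2)

theorem contDiff_cutoffGaussian {n : ℕ} {k : ℕ∞} (μ : ℝ) {χ : EuclideanSpace ℝ (Fin n) → ℝ}
    (hχ : ContDiff ℝ k χ) : ContDiff ℝ k (cutoffGaussian μ χ) :=
  hχ.mul (contDiff_const.mul (contDiff_id.norm_sq ℝ)).exp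

theorem gradient_cutoffGaussian_add {n : ℕ} (μ : ℝ) {χ : EuclideanSpace ℝ (Fin n) → ℝ}
    {x : EuclideanSpace ℝ (Fin n)} (hχ : DifferentiableAt ℝ χ x) :
    gradient (cutoffGaussian μ χ) x + (μ * cutoffGaussian μ χ x) • x
      = Real.exp (-(μ / 2) * ‖x‖ ^ 2) • gradient χ x := by
  have h1 : HasFDerivAt (fun y : EuclideanSpace ℝ (Fin n) => ‖y‖ ^ 2)
      (2 • innerSL ℝ x) x := (hasStrictFDerivAt_norm_sq x).hasFDerivAt
  have h2 := hχ.hasFDerivAt.mul (h1.const_mul (-(μ / 2))).exp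
  have h3 : fderiv ℝ (cutoffGaussian μ χ) x = _ := h2.fderiv
  refine ext_inner_right ℝ fun v => ?_
  rw [inner_add_left, inner_smul_left, inner_smul_left]
  simp only [gradient, InnerProductSpace.toDual_symm_apply, h3]
  simp [cutoffGaussian]
  ring

theorem exists_smooth_cutoff (n : ℕ) {R : ℝ} (hR : 0 < R) :
    ∃ χ : EuclideanSpace ℝ (Fin n) → ℝ, ContDiff ℝ (⊤ : ℕ∞) χ ∧ HasCompactSupport χ ∧
      tsupport χ ⊆ ball (0 : EuclideanSpace ℝ (Fin n)) R ∧ ∀ x, ‖x‖ ≤ R / 2 → χ x = 1 := by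
  let χ : ContDiffBump (0 : EuclideanSpace ℝ (Fin n)) :=
    ⟨R / 2, 3 * R / 4, by positivity, by linarith⟩
  refine ⟨χ, χ.contDiff, χ.hasCompactSupport, ?_, fun x hx =>
    χ.one_of_mem_closedBall (mem_closedBall_zero_iff.2 hx)⟩
  rw [χ.tsupport_eq]
  exact closedBall_subset_ball (by change 3 * R / 4 < R; linarith)

/-- The excess energy of a cut-off Gaussian is exponentially small. -/
theorem exists_rayleigh_le (n : ℕ) {R : ℝ} (hR : 0 < R) :
    ∃ C : ℝ, 0 ≤ C ∧ ∀ μ : ℝ, 0 ≤ μ → ∃ w : EuclideanSpace ℝ (Fin n) → ℝ,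
      ContDiff ℝ (⊤ : ℕ∞) w ∧ HasCompactSupport w ∧
      tsupport w ⊆ ball (0 : EuclideanSpace ℝ (Fin n)) R ∧ w ≠ 0 ∧
      rayleigh n R μ w ≤ n * μ + C * Real.exp (-(3 * R ^ 2 / 16) * μ) := by
  obtain ⟨χ, hχ, hχc, hχs, hχ_one⟩ := exists_smooth_cutoff n hR
  have hχ1 : ContDiff ℝ 1 χ := hχ.of_le (by exact_mod_cast le_top)
  have hgrad := continuous_gradient hχ1
  have hgI : Integrable fun x => ‖gradient χ x‖ ^ 2 :=
    Continuous.integrable_of_hasCompactSupport (by fun_prop)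
      (hasCompactSupport_gradient_sq hχc)
  have hgz : ∀ x, ‖x‖ < R / 2 → gradient χ x = 0 := by
    intro x hx
    have h : χ =ᶠ[nhds x] fun _ => 1 := by
      filter_upwards [isOpen_ball.mem_nhds (mem_ball_zero_iff.2 hx)] with y hy
      exact hχ_one y (mem_ball_zero_iff.1 hy).le
    simp [gradient, h.fderiv_eq]
  set V := volume.real (ball (0 : EuclideanSpace ℝ (Fin n)) (R / 4))
  have hVpos : 0 < V :=
    ENNReal.toReal_pos (measure_ball_pos _ _ (by positivity)).ne' measure_ball_lt_top.ne
  refine ⟨(∫ x, ‖gradient χ x‖ ^ 2) / V, by positivity, fun μ hμ =>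
    ⟨cutoffGaussian μ χ, ?_⟩⟩
  have hw : ContDiff ℝ (⊤ : ℕ∞) (cutoffGaussian μ χ) := contDiff_cutoffGaussian μ hχ
  have hc : HasCompactSupport (cutoffGaussian μ χ) := hχc.mul_right
  have hs : tsupport (cutoffGaussian μ χ) ⊆ ball (0 : EuclideanSpace ℝ (Fin n)) R :=
    (tsupport_mul_subset_left (f := χ)).trans hχs
  have h0 : cutoffGaussian μ χ ≠ 0 := by
    refine Function.ne_iff.2 ⟨0, ?_⟩
    have : χ 0 = 1 := hχ_one 0 (by rw [norm_zero]; positivity)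
    simp [cutoffGaussian, this]
  refine ⟨hw, hc, hs, h0, ?_⟩
  rw [rayleigh_eq μ (hw.of_le (by exact_mod_cast le_top)) hc hs h0]
  have hnum : ∫ x, ‖gradient (cutoffGaussian μ χ) x + (μ * cutoffGaussian μ χ x) • x‖ ^ 2
      ≤ Real.exp (-(R ^ 2 / 4) * μ) * ∫ x, ‖gradient χ x‖ ^ 2 := by
    rw [← integral_const_mul]
    refine integral_mono_of_nonneg (Eventually.of_forall fun x => by positivity)
      (hgI.const_mul _) (Eventually.of_forall fun x => ?_)
    simp only [gradient_cutoffGaussian_add μ (hχ1.differentiable one_ne_zero x)]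
    rcases lt_or_ge ‖x‖ (R / 2) with hx | hx
    · simp [hgz x hx]
    · rw [norm_smul, mul_pow, Real.norm_eq_abs, sq_abs, ← Real.exp_nat_mul]
      refine mul_le_mul_of_nonneg_right (Real.exp_le_exp.2 ?_) (sq_nonneg _)
      push_cast
      have := mul_le_mul_of_nonneg_left (pow_le_pow_left₀ (by positivity) hx 2) hμ
      nlinarith
  have hden : Real.exp (-(R ^ 2 / 16) * μ) * V ≤ ∫ x, cutoffGaussian μ χ x ^ 2 := by
    have hI := integrable_sq hw.continuous hc
    calc Real.exp (-(R ^ 2 / 16) * μ) * V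
        = ∫ _ in ball (0 : EuclideanSpace ℝ (Fin n)) (R / 4),
            Real.exp (-(R ^ 2 / 16) * μ) := by
          rw [setIntegral_const, smul_eq_mul, mul_comm]
      _ ≤ ∫ x in ball (0 : EuclideanSpace ℝ (Fin n)) (R / 4), cutoffGaussian μ χ x ^ 2 := by
          refine setIntegral_mono_on (integrableOn_const measure_ball_lt_top.ne)
            hI.integrableOn measurableSet_ball fun x hx => ?_
          rw [mem_ball_zero_iff] at hx
          have h1 : χ x = 1 := hχ_one x (by linarith)
          rw [cutoffGaussian, h1, one_mul, ← Real.exp_nat_mul]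
          refine Real.exp_le_exp.2 ?_
          push_cast
          have := mul_le_mul_of_nonneg_left (pow_le_pow_left₀ (norm_nonneg x) hx.le 2) hμ
          nlinarith
      _ ≤ ∫ x, cutoffGaussian μ χ x ^ 2 :=
          setIntegral_le_integral hI (Eventually.of_forall fun x => sq_nonneg _)
  have hexp : Real.exp (-(R ^ 2 / 4) * μ) =
      Real.exp (-(3 * R ^ 2 / 16) * μ) * Real.exp (-(R ^ 2 / 16) * μ) := by
    rw [← Real.exp_add]
    ring_nf
  have hG : 0 ≤ ∫ x, ‖gradient χ x‖ ^ 2 := by positivity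
  gcongr
  calc _ ≤ (Real.exp (-(R ^ 2 / 4) * μ) * ∫ x, ‖gradient χ x‖ ^ 2) /
        (Real.exp (-(R ^ 2 / 16) * μ) * V) := by gcongr
    _ = _ := by
      rw [hexp]
      field_simp

/-- For every `μ ≥ 0`, `d μ ≤ ν_μ`, and `ν_μ − d μ → 0` as `μ → ∞`;
equivalently, there is a continuous nonnegative function `κ` on `[0,∞)` with `κ(μ) → 0`
at infinity such that `d μ ≤ ν_μ ≤ d μ + κ(μ)` for all `μ ≥ 0`. -/
theorem statement16 (d : ℕ) (hd : 1 ≤ d) (R : ℝ) (hR : 0 < R) :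
    (∀ μ : ℝ, 0 ≤ μ → (d : ℝ) * μ ≤ nuBottom d R μ) ∧
    Tendsto (fun μ : ℝ => nuBottom d R μ - d * μ) atTop (nhds 0) ∧
    ∃ κ : ℝ → ℝ, ContinuousOn κ (Ici 0) ∧ (∀ μ : ℝ, 0 ≤ μ → 0 ≤ κ μ) ∧
      Tendsto κ atTop (nhds 0) ∧
      ∀ μ : ℝ, 0 ≤ μ → (d : ℝ) * μ ≤ nuBottom d R μ ∧ nuBottom d R μ ≤ d * μ + κ μ := by
  obtain ⟨C, hC, hup⟩ := exists_rayleigh_le d hR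
  have hle : ∀ μ : ℝ, ∀ ν ∈ {ν : ℝ | ∃ w : EuclideanSpace ℝ (Fin d) → ℝ,
      ContDiff ℝ (⊤ : ℕ∞) w ∧ HasCompactSupport w ∧
      tsupport w ⊆ ball (0 : EuclideanSpace ℝ (Fin d)) R ∧ w ≠ 0 ∧ ν = rayleigh d R μ w},
      (d : ℝ) * μ ≤ ν := by
    rintro μ _ ⟨w, hw, hc, hs, h0, rfl⟩
    exact le_rayleigh μ (hw.of_le (by exact_mod_cast le_top)) hc hs h0
  have hlow : ∀ μ : ℝ, 0 ≤ μ → (d : ℝ) * μ ≤ nuBottom d R μ := by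
    intro μ hμ
    obtain ⟨w, hw, hc, hs, h0, -⟩ := hup μ hμ
    exact le_csInf ⟨_, w, hw, hc, hs, h0, rfl⟩ (hle μ)
  have hupp : ∀ μ : ℝ, 0 ≤ μ →
      nuBottom d R μ ≤ d * μ + C * Real.exp (-(3 * R ^ 2 / 16) * μ) := by
    intro μ hμ
    obtain ⟨w, hw, hc, hs, h0, h⟩ := hup μ hμ
    exact (csInf_le ⟨_, hle μ⟩ ⟨w, hw, hc, hs, h0, rfl⟩).trans h
  have hlim : Tendsto (fun μ : ℝ => C * Real.exp (-(3 * R ^ 2 / 16) * μ)) atTop (nhds 0) := by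
    rw [← mul_zero C]
    refine (Real.tendsto_exp_atBot.comp (tendsto_id.const_mul_atTop_of_neg ?_)).const_mul C
    exact neg_lt_zero.2 (by positivity)
  refine ⟨hlow, ?_, fun μ => C * Real.exp (-(3 * R ^ 2 / 16) * μ), ?_, ?_, hlim,
    fun μ hμ => ⟨hlow μ hμ, hupp μ hμ⟩⟩
  · refine squeeze_zero' ?_ ?_ hlim
    · filter_upwards [eventually_ge_atTop 0] with μ hμ
      linarith [hlow μ hμ]
    · filter_upwards [eventually_ge_atTop 0] with μ hμ
      linarith [hupp μ hμ]
  · fun_prop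
  · intro μ _
    positivity
end
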